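/- There exists a constant c > 0 such that for every finite nonempty set S ⊂ ℤ² and every function a : ℤ² → ℂ supported on S, the function u(t,x) = Σ_{ξ∈S} a(ξ) e^{i(ξ·x − t|ξ|²)} satisfies (∫_0^{2π} ∫_{𝕋²} |u(t,x)|⁴ dx dt)^{1/4} ≤ c (Log #S)^{1/4} (Σ_{ξ∈S} |a(ξ)|²)^{1/2}. -/

import Mathlib

open MeasureTheory
open scoped BigOperators Real

namespace Strichartz

section Planar

variable {α : Type*} (X Y : α → ℚ)

/-- The slope of the segment joining the endpoints of `e`. -/
def slope (e : α × α) : ℚ := (Y e.2 - Y e.1) / (X e.2 - X e.1)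

/-- The ordinate at abscissa `x` of the line through the endpoints of `e`. -/
def ordinate (e : α × α) (x : ℚ) : ℚ := Y e.1 + slope X Y e * (x - X e.1)

/-- Two segments cross if their vertical order changes over a common abscissa interval. -/
def Crosses (e f : α × α) : Prop :=
  ∃ x₀ x₁ : ℚ, x₀ ∈ Set.Icc (X e.1) (X e.2) ∧ x₀ ∈ Set.Icc (X f.1) (X f.2) ∧
    x₁ ∈ Set.Icc (X e.1) (X e.2) ∧ x₁ ∈ Set.Icc (X f.1) (X f.2) ∧
    ordinate X Y e x₀ < ordinate X Y f x₀ ∧ ordinate X Y f x₁ < ordinate X Y e x₁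

variable {X Y}

lemma ordinate_fst (e : α × α) : ordinate X Y e (X e.1) = Y e.1 := by simp [ordinate]

lemma ordinate_snd {e : α × α} (h : X e.1 < X e.2) : ordinate X Y e (X e.2) = Y e.2 := by
  have : X e.2 - X e.1 ≠ 0 := by linarith
  simp only [ordinate, slope]
  field_simp
  ring

lemma ordinate_lt_ordinate {e f : α × α} (h : e.1 = f.1) (hs : slope X Y e < slope X Y f)
    {x : ℚ} (hx : X e.1 < x) : ordinate X Y e x < ordinate X Y f x := by
  simp only [ordinate, ← h]
  nlinarith

/-- `e'` is the edge following `e` in counterclockwise order around their left endpoint, and `w`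
is the leftmost vertex of `T` in the wedge between them. -/
structure IsWedge (X Y : α → ℚ) (T : Finset α) (E : Finset (α × α)) (e e' : α × α) (w : α) :
    Prop where
  mem : e ∈ E
  mem' : e' ∈ E
  fst_eq : e'.1 = e.1
  slope_lt : slope X Y e < slope X Y e'
  slope_le : ∀ f ∈ E, f.1 = e.1 → slope X Y e < slope X Y f → slope X Y e' ≤ slope X Y f
  lt : X e.1 < X w
  le : X w ≤ X e.2
  le' : X w ≤ X e'.2
  above : ordinate X Y e (X w) ≤ Y w
  below : Y w ≤ ordinate X Y e' (X w)
  leftmost : ∀ z ∈ T, X e.1 < X z → X z < X w → ordinate X Y e (X z) ≤ Y z →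
    ordinate X Y e' (X z) < Y z

variable {T : Finset α} {E : Finset (α × α)}

lemma exists_isWedge (hE : ∀ e ∈ E, e.1 ∈ T ∧ e.2 ∈ T ∧ X e.1 < X e.2) {e : α × α} (he : e ∈ E)
    (htop : ∃ f ∈ E, f.1 = e.1 ∧ slope X Y e < slope X Y f) :
    ∃ e' w, w ∈ T ∧ IsWedge X Y T E e e' w := by
  classical
  obtain ⟨f, hf, hfe, hsf⟩ := htop
  obtain ⟨e', he', hmin⟩ := Finset.exists_min_image
    (E.filter fun f => f.1 = e.1 ∧ slope X Y e < slope X Y f) (slope X Y)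
    ⟨f, by simp [hf, hfe, hsf]⟩
  simp only [Finset.mem_filter] at he' hmin
  obtain ⟨he'E, hfst, hslope⟩ := he'
  have h1 := hE e he
  have h2 := hE e' he'E
  obtain ⟨w, hw, hwmin⟩ := Finset.exists_min_image
    (T.filter fun w => X e.1 < X w ∧ X w ≤ X e.2 ∧ X w ≤ X e'.2 ∧
      ordinate X Y e (X w) ≤ Y w ∧ Y w ≤ ordinate X Y e' (X w)) X (by
      rcases le_total (X e.2) (X e'.2) with h | h
      · refine ⟨e.2, ?_⟩
        have := ordinate_lt_ordinate (X := X) (Y := Y) hfst.symm hslope h1.2.2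
        rw [ordinate_snd h1.2.2] at this
        simp [h1, h, ordinate_snd h1.2.2, this.le]
      · refine ⟨e'.2, ?_⟩
        have h3 : X e.1 < X e'.2 := by rw [← hfst]; exact h2.2.2
        have := ordinate_lt_ordinate (X := X) (Y := Y) hfst.symm hslope h3
        rw [ordinate_snd h2.2.2] at this
        simp [h2, h, h3, ordinate_snd h2.2.2, this.le])
  simp only [Finset.mem_filter] at hw hwmin
  obtain ⟨hwT, hw1, hw2, hw3, hw4, hw5⟩ := hw
  refine ⟨e', w, hwT, he, he'E, hfst, hslope, fun g hg hge hs => hmin g ⟨hg, hge, hs⟩,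
    hw1, hw2, hw3, hw4, hw5, fun z hz hz1 hz2 hz3 => ?_⟩
  by_contra! hcon
  exact absurd (hwmin z ⟨hz, hz1, by linarith, by linarith, hz3, hcon⟩) (by linarith)

lemma IsWedge.ordinate_lt {e e' : α × α} {w : α} (h : IsWedge X Y T E e e' w) :
    ordinate X Y e (X w) < ordinate X Y e' (X w) :=
  ordinate_lt_ordinate h.fst_eq.symm h.slope_lt h.lt

lemma IsWedge.slope_not_lt {e e' f f' : α × α} {w : α} (h : IsWedge X Y T E e e' w)
    (k : IsWedge X Y T E f f' w) (hv : e.1 = f.1)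
    (htype : ordinate X Y e (X w) = Y w ↔ ordinate X Y f (X w) = Y w) :
    ¬ slope X Y e < slope X Y f := by
  intro hs
  have h1 : slope X Y e' ≤ slope X Y f := h.slope_le f k.mem hv.symm hs
  have h2 : ordinate X Y e' (X w) ≤ ordinate X Y f (X w) := by
    have := h.lt
    simp only [ordinate, h.fst_eq, ← hv]
    nlinarith
  have h3 := h.ordinate_lt
  have h4 := h.below
  have h5 := k.above
  have := htype.2 (by linarith)
  linarith

lemma IsWedge.not_fst_lt {e e' f f' : α × α} {w : α}
    (hE : ∀ e ∈ E, e.1 ∈ T ∧ e.2 ∈ T ∧ X e.1 < X e.2)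
    (hc : ∀ e ∈ E, ∀ f ∈ E, ¬ Crosses X Y e f) (h : IsWedge X Y T E e e' w)
    (k : IsWedge X Y T E f f' w)
    (htype : ordinate X Y e (X w) = Y w ↔ ordinate X Y f (X w) = Y w) :
    ¬ X e.1 < X f.1 := by
  intro hlt
  have h1 := h.ordinate_lt
  have k1 := k.ordinate_lt
  have h2 := h.above
  have h3 := h.below
  have h4 := h.le
  have h5 := h.le'
  have k2 := k.above
  have k3 := k.below
  have k4 := k.le
  have k5 := k.le'
  have k6 := k.lt
  by_cases hz : ordinate X Y e (X f.1) ≤ Y f.1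
  · have h6 := h.leftmost f.1 (hE f k.mem).1 hlt k.lt hz
    have h7 : ordinate X Y f (X w) < ordinate X Y e' (X w) := by
      refine lt_of_le_of_ne (k2.trans h3) fun heq => ?_
      have := htype.2 (by linarith)
      linarith
    refine hc e' h.mem' f k.mem ⟨X f.1, X w, ⟨?_, ?_⟩, ⟨?_, ?_⟩, ⟨?_, ?_⟩, ⟨?_, ?_⟩, ?_, h7⟩
    all_goals try rw [h.fst_eq]
    all_goals try linarith
    rw [ordinate_fst]; exact h6
  · push Not at hz
    have h7 : ordinate X Y e (X w) < ordinate X Y f' (X w) := by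
      refine lt_of_le_of_ne (h2.trans k3) fun heq => ?_
      have := htype.1 (by linarith)
      linarith
    refine hc f' k.mem' e h.mem ⟨X f.1, X w, ⟨?_, ?_⟩, ⟨?_, ?_⟩, ⟨?_, ?_⟩, ⟨?_, ?_⟩, ?_, h7⟩
    all_goals try rw [k.fst_eq]
    all_goals try linarith
    have : ordinate X Y f' (X f.1) = Y f.1 := by rw [← k.fst_eq, ordinate_fst]
    rw [this]; exact hz

/-- A straight-line plane graph on `n` vertices has at most `3 n` edges. -/
theorem card_edges_le (hX : Set.InjOn X T) (hE : ∀ e ∈ E, e.1 ∈ T ∧ e.2 ∈ T ∧ X e.1 < X e.2)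
    (hs : ∀ e ∈ E, ∀ f ∈ E, e.1 = f.1 → slope X Y e = slope X Y f → e = f)
    (hc : ∀ e ∈ E, ∀ f ∈ E, ¬ Crosses X Y e f) : E.card ≤ 3 * T.card := by
  classical
  set P : α × α → Prop := fun e => ∃ f ∈ E, f.1 = e.1 ∧ slope X Y e < slope X Y f
  have hw : ∀ e : α × α, ∃ e' w, e ∈ E.filter P → w ∈ T ∧ IsWedge X Y T E e e' w := by
    intro e
    by_cases he : e ∈ E.filter P
    · simp only [Finset.mem_filter] at he
      obtain ⟨e', w, h⟩ := exists_isWedge hE he.1 he.2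
      exact ⟨e', w, fun _ => h⟩
    · exact ⟨e, e.1, fun h => absurd h he⟩
  choose n w hnw using hw
  have h1 : (E.filter fun e => ¬ P e).card ≤ T.card := by
    refine Finset.card_le_card_of_injOn Prod.fst (fun e he => ?_) fun e he f hf hef => ?_
    · simp only [Finset.coe_filter, Set.mem_ofPred_eq] at he
      exact (hE e he.1).1
    · simp only [Finset.coe_filter, Set.mem_ofPred_eq, P, not_exists, not_and, not_lt] at he hf
      exact hs e he.1 f hf.1 hef (le_antisymm (hf.2 e he.1 hef) (he.2 f hf.1 hef.symm))
  have h2 : (E.filter P).card ≤ (T ×ˢ (Finset.univ : Finset Bool)).card := by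
    refine Finset.card_le_card_of_injOn
      (fun e => (w e, decide (ordinate X Y e (X (w e)) = Y (w e)))) (fun e he => ?_)
      fun e he f hf hef => ?_
    · simp [(hnw e he).1, em]
    · simp only [Prod.mk.injEq, decide_eq_decide] at hef
      obtain ⟨hwe, htype⟩ := hef
      have h := (hnw e he).2
      have k := (hnw f hf).2
      rw [← hwe] at k htype
      have h3 := h.not_fst_lt hE hc k htype
      have h4 := k.not_fst_lt hE hc h htype.symm
      have h5 : e.1 = f.1 :=
        hX (hE e h.mem).1 (hE f k.mem).1 (le_antisymm (not_lt.1 h4) (not_lt.1 h3))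
      exact hs e h.mem f k.mem h5 (le_antisymm
        (not_lt.1 (k.slope_not_lt h h5.symm htype.symm)) (not_lt.1 (h.slope_not_lt k h5 htype)))
  have h3 := Finset.card_filter_add_card_filter_not (s := E) P
  simp only [Finset.card_product, Finset.card_univ, Fintype.card_bool] at h2
  omega

end Planar

section Incidence

variable {α : Type*} {X Y : α → ℚ} {T : Finset α} {E : Finset (α × α)}

open Classical in
lemma card_edges_le_add_crossings (hX : Set.InjOn X T)
    (hE : ∀ e ∈ E, e.1 ∈ T ∧ e.2 ∈ T ∧ X e.1 < X e.2)
    (hs : ∀ e ∈ E, ∀ f ∈ E, e.1 = f.1 → slope X Y e = slope X Y f → e = f) :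
    E.card ≤ 3 * T.card + ((E ×ˢ E).filter fun c => Crosses X Y c.1 c.2).card := by
  set B : Finset (α × α) := E.filter fun e => ∃ f ∈ E, Crosses X Y e f
  have h1 : (E \ B).card ≤ 3 * T.card := by
    refine card_edges_le (X := X) (Y := Y) hX (fun e he => hE e (Finset.mem_sdiff.1 he).1)
      (fun e he f hf => hs e (Finset.mem_sdiff.1 he).1 f (Finset.mem_sdiff.1 hf).1)
      fun e he f hf hc => ?_
    rw [Finset.mem_sdiff] at he hf
    exact he.2 (Finset.mem_filter.2 ⟨he.1, f, hf.1, hc⟩)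
  have h2 : B.card ≤ ((E ×ˢ E).filter fun c => Crosses X Y c.1 c.2).card := by
    refine (Finset.card_le_card fun e he => ?_).trans (Finset.card_image_le (f := Prod.fst))
    obtain ⟨h, f, hf, hc⟩ := Finset.mem_filter.1 he
    exact Finset.mem_image.2 ⟨(e, f), by simp [h, hf, hc], rfl⟩
  have h3 : E.card ≤ (E \ B).card + B.card := by
    have := Finset.le_card_sdiff B E
    omega
  omega

lemma sum_weight_superset [DecidableEq α] {P U : Finset α} (hU : U ⊆ P) (p : ℝ) :
    ∑ T ∈ P.powerset with U ⊆ T, p ^ T.card * (1 - p) ^ (P \ T).card = p ^ U.card := by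
  have h := Finset.prod_add (fun _ => p) (fun i => if i ∈ U then 0 else 1 - p) P
  have h1 : ∏ i ∈ P, (p + if i ∈ U then 0 else 1 - p) = p ^ U.card := by
    have : ∀ i ∈ P, (p + if i ∈ U then 0 else 1 - p) = if i ∈ U then p else 1 := by
      intro i _
      split_ifs <;> ring
    rw [Finset.prod_congr rfl this, Finset.prod_ite_mem, Finset.inter_eq_right.2 hU,
      Finset.prod_const]
  rw [← h1, h, Finset.sum_filter]
  refine Finset.sum_congr rfl fun T hT => ?_
  split_ifs with hUT
  · rw [Finset.prod_const]
    congr 1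
    rw [← Finset.prod_const]
    refine Finset.prod_congr rfl fun i hi => ?_
    rw [if_neg fun hiU => (Finset.mem_sdiff.1 hi).2 (hUT hiU)]
  · obtain ⟨i, hiU, hiT⟩ := Finset.not_subset.1 hUT
    rw [Finset.prod_eq_zero (i := i) (Finset.mem_sdiff.2 ⟨hU hiU, hiT⟩) (by simp [hiU]), mul_zero]

lemma sum_weight_mul_card [DecidableEq α] {ι : Type*} {P : Finset α} (J : Finset ι)
    (U : ι → Finset α) {n : ℕ} (hU : ∀ j ∈ J, U j ⊆ P ∧ (U j).card = n) (p : ℝ) :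
    ∑ T ∈ P.powerset, p ^ T.card * (1 - p) ^ (P \ T).card * ((J.filter fun j => U j ⊆ T).card : ℝ)
      = p ^ n * J.card := by
  have : ∀ T ∈ P.powerset, p ^ T.card * (1 - p) ^ (P \ T).card *
      ((J.filter fun j => U j ⊆ T).card : ℝ) =
      ∑ j ∈ J, if U j ⊆ T then p ^ T.card * (1 - p) ^ (P \ T).card else 0 := by
    intro T _
    rw [Finset.card_filter]
    push_cast
    rw [Finset.mul_sum]
    exact Finset.sum_congr rfl fun j _ => by split_ifs <;> simp
  rw [Finset.sum_congr rfl this, Finset.sum_comm]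
  have : ∀ j ∈ J, (∑ T ∈ P.powerset, if U j ⊆ T then p ^ T.card * (1 - p) ^ (P \ T).card else 0)
      = p ^ n := by
    intro j hj
    rw [← Finset.sum_filter, sum_weight_superset (hU j hj).1, (hU j hj).2]
  rw [Finset.sum_congr rfl this, Finset.sum_const, nsmul_eq_mul, mul_comm]

lemma Crosses.ne {e f : α × α} (he : X e.1 < X e.2) (hf : X f.1 < X f.2)
    (h : Crosses X Y e f) : e.1 ≠ f.1 ∧ e.1 ≠ f.2 ∧ e.2 ≠ f.1 ∧ e.2 ≠ f.2 := by
  obtain ⟨x₀, x₁, ⟨h1, h2⟩, ⟨h3, h4⟩, ⟨h5, h6⟩, ⟨h7, h8⟩, h9, h10⟩ := h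
  have he2 := ordinate_snd (X := X) (Y := Y) he
  have hf2 := ordinate_snd (X := X) (Y := Y) hf
  refine ⟨fun h => ?_, fun h => ?_, fun h => ?_, fun h => ?_⟩
  · simp only [ordinate, ← h] at *
    rcases le_total (slope X Y e) (slope X Y f) with hs | hs <;> nlinarith
  · have hX : X e.1 = X f.2 := by rw [h]
    have a : x₀ = X e.1 := by linarith
    have b : x₁ = X e.1 := by linarith
    rw [a] at h9; rw [b] at h10; linarith
  · have hX : X e.2 = X f.1 := by rw [h]
    have a : x₀ = X e.2 := by linarith
    have b : x₁ = X e.2 := by linarith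
    rw [a] at h9; rw [b] at h10; linarith
  · rw [← h] at hf2 h4 h8
    simp only [ordinate] at *
    have e1 : Y e.1 = Y e.2 - slope X Y e * (X e.2 - X e.1) := by linarith
    have e2 : Y f.1 = Y e.2 - slope X Y f * (X e.2 - X f.1) := by linarith
    rw [e1, e2] at h9 h10
    rcases le_total (slope X Y e) (slope X Y f) with hs | hs <;> nlinarith

open Classical in
/-- The crossing number inequality for straight-line drawings, in random sampling form. -/
lemma crossing_sampling (hX : Set.InjOn X T)
    (hE : ∀ e ∈ E, e.1 ∈ T ∧ e.2 ∈ T ∧ X e.1 < X e.2)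
    (hs : ∀ e ∈ E, ∀ f ∈ E, e.1 = f.1 → slope X Y e = slope X Y f → e = f)
    {p : ℝ} (hp0 : 0 ≤ p) (hp1 : p ≤ 1) :
    p ^ 2 * E.card ≤ 3 * (p * T.card) +
      p ^ 4 * ((E ×ˢ E).filter fun c => Crosses X Y c.1 c.2).card := by
  set C := (E ×ˢ E).filter fun c => Crosses X Y c.1 c.2
  have hne : ∀ e ∈ E, e.1 ≠ e.2 := fun e he h => by
    have := (hE e he).2.2
    rw [h] at this
    exact lt_irrefl _ this
  have h1 := sum_weight_mul_card (P := T) E (fun e => {e.1, e.2}) (n := 2) (fun e he => by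
    refine ⟨by simp [Finset.insert_subset_iff, hE e he], Finset.card_pair (hne e he)⟩) p
  have h2 := sum_weight_mul_card (P := T) T (fun v => {v}) (n := 1)
    (fun v hv => by simpa using hv) p
  have h3 := sum_weight_mul_card (P := T) C (fun c => {c.1.1, c.1.2, c.2.1, c.2.2}) (n := 4)
    (fun c hc => by
      obtain ⟨hc1, hc2⟩ := Finset.mem_filter.1 hc
      obtain ⟨hc1, hc3⟩ := Finset.mem_product.1 hc1
      obtain ⟨n1, n2, n3, n4⟩ := hc2.ne (hE _ hc1).2.2 (hE _ hc3).2.2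
      refine ⟨by simp [Finset.insert_subset_iff, hE _ hc1, hE _ hc3], ?_⟩
      rw [Finset.card_insert_of_notMem, Finset.card_insert_of_notMem, Finset.card_pair (hne _ hc3)]
      · simp [n3, n4]
      · simp [n1, n2, hne _ hc1]) p
  rw [pow_one] at h2
  rw [← h1, ← h2, ← h3, Finset.mul_sum, ← Finset.sum_add_distrib]
  refine Finset.sum_le_sum fun U hU => ?_
  have hUT := Finset.mem_powerset.1 hU
  have hw : 0 ≤ p ^ U.card * (1 - p) ^ (T \ U).card :=
    mul_nonneg (pow_nonneg hp0 _) (pow_nonneg (by linarith) _)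
  have key := card_edges_le_add_crossings (X := X) (Y := Y) (T := U)
    (E := E.filter fun e => ({e.1, e.2} : Finset α) ⊆ U) (hX.mono hUT)
    (fun e he => by
      obtain ⟨he1, he2⟩ := Finset.mem_filter.1 he
      simp only [Finset.insert_subset_iff, Finset.singleton_subset_iff] at he2
      exact ⟨he2.1, he2.2, (hE e he1).2.2⟩)
    (fun e he f hf => hs e (Finset.mem_filter.1 he).1 f (Finset.mem_filter.1 hf).1)
  have e1 : (T.filter fun v => ({v} : Finset α) ⊆ U) = U := by
    ext v
    simp only [Finset.mem_filter, Finset.singleton_subset_iff]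
    exact ⟨fun h => h.2, fun h => ⟨hUT h, h⟩⟩
  have e2 : (((E.filter fun e => ({e.1, e.2} : Finset α) ⊆ U) ×ˢ
      (E.filter fun e => ({e.1, e.2} : Finset α) ⊆ U)).filter fun c => Crosses X Y c.1 c.2) =
      C.filter fun c => ({c.1.1, c.1.2, c.2.1, c.2.2} : Finset α) ⊆ U := by
    ext c
    simp only [C, Finset.mem_filter, Finset.mem_product, Finset.insert_subset_iff,
      Finset.singleton_subset_iff]
    tauto
  rw [e2] at key
  have key' : ((E.filter fun e => ({e.1, e.2} : Finset α) ⊆ U).card : ℝ) ≤ 3 * U.card +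
      (C.filter fun c => ({c.1.1, c.1.2, c.2.1, c.2.2} : Finset α) ⊆ U).card := by
    exact_mod_cast key
  rw [e1]
  nlinarith [mul_le_mul_of_nonneg_left key' hw]

open Classical in
lemma card_edges_le_or (hX : Set.InjOn X T)
    (hE : ∀ e ∈ E, e.1 ∈ T ∧ e.2 ∈ T ∧ X e.1 < X e.2)
    (hs : ∀ e ∈ E, ∀ f ∈ E, e.1 = f.1 → slope X Y e = slope X Y f → e = f) {N : ℝ}
    (hC : (((E ×ˢ E).filter fun c => Crosses X Y c.1 c.2).card : ℝ) ≤ N) :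
    (E.card : ℝ) ≤ 6 * T.card ∨ (E.card : ℝ) ^ 3 ≤ 72 * (T.card : ℝ) ^ 2 * N := by
  by_cases h : (E.card : ℝ) ≤ 6 * T.card
  · exact Or.inl h
  right
  push Not at h
  set V : ℝ := (T.card : ℝ) with hVdef
  set e : ℝ := (E.card : ℝ) with he_def
  have hV : 0 ≤ V := Nat.cast_nonneg _
  have he : 0 < e := by linarith
  rcases hV.eq_or_lt with h0 | hVpos
  · have hT : T = ∅ := by
      rw [← Finset.card_eq_zero]
      exact Nat.cast_eq_zero.1 (h0.symm : (T.card : ℝ) = 0)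
    have : E = ∅ := by
      refine Finset.eq_empty_of_forall_notMem fun x hx => ?_
      have := (hE x hx).1
      simp [hT] at this
    simp [e, this] at he
  have key := crossing_sampling (X := X) (Y := Y) hX hE hs (p := 6 * V / e) (by positivity)
    (by rw [div_le_one he]; exact h.le)
  have key2 := key.trans (add_le_add_right (mul_le_mul_of_nonneg_left hC (by positivity)) _)
  rw [show (6 * V / e) ^ 2 * e = 36 * V ^ 2 / e by field_simp; ring,
    show 3 * (6 * V / e * V) + (6 * V / e) ^ 4 * N
      = (18 * V ^ 2 * e ^ 3 + 1296 * V ^ 4 * N) / e ^ 4 by field_simp; ring,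
    div_le_div_iff₀ he (by positivity)] at key2
  have : (18 * V ^ 2 * e) * e ^ 3 ≤ (18 * V ^ 2 * e) * (72 * V ^ 2 * N) := by nlinarith
  exact le_of_mul_le_mul_left this (by positivity)

end Incidence

section SzemerediTrotter

variable {α : Type*} {X Y : α → ℚ}

/-- The point `p` lies on the line with slope `l.1` and intercept `l.2`. -/
def OnLine (X Y : α → ℚ) (p : α) (l : ℚ × ℚ) : Prop := Y p = l.1 * X p + l.2

/-- The line through the endpoints of `e`, as a pair (slope, intercept). -/
def lineOf (X Y : α → ℚ) (e : α × α) : ℚ × ℚ := (slope X Y e, ordinate X Y e 0)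

/-- The points of `e` are consecutive among the points of `P` on their common line. -/
structure IsConsecutive (X Y : α → ℚ) (P : Finset α) (e : α × α) : Prop where
  mem_fst : e.1 ∈ P
  mem_snd : e.2 ∈ P
  lt : X e.1 < X e.2
  not_between : ∀ r ∈ P, OnLine X Y r (lineOf X Y e) → X e.1 < X r → X e.2 ≤ X r

lemma ordinate_eq (e : α × α) (x : ℚ) :
    ordinate X Y e x = (lineOf X Y e).1 * x + (lineOf X Y e).2 := by
  simp only [lineOf, ordinate]; ring

lemma onLine_fst (e : α × α) : OnLine X Y e.1 (lineOf X Y e) := by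
  rw [OnLine, ← ordinate_eq, ordinate_fst]

lemma onLine_snd {e : α × α} (h : X e.1 ≠ X e.2) : OnLine X Y e.2 (lineOf X Y e) := by
  have : X e.2 - X e.1 ≠ 0 := sub_ne_zero.2 h.symm
  simp only [OnLine, lineOf, ordinate, slope]
  field_simp
  ring

lemma lineOf_eq {p q : α} {l : ℚ × ℚ} (h : X p ≠ X q) (hp : OnLine X Y p l)
    (hq : OnLine X Y q l) : lineOf X Y (p, q) = l := by
  have h0 : X q - X p ≠ 0 := sub_ne_zero.2 h.symm
  have hs : slope X Y (p, q) = l.1 := by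
    simp only [slope]
    rw [div_eq_iff h0, hp, hq]
    ring
  refine Prod.ext hs ?_
  simp only [lineOf, ordinate, hs]
  rw [hp]
  ring

variable {P : Finset α} {L : Finset (ℚ × ℚ)}

lemma IsConsecutive.eq_of_mem_Ioo {e f : α × α} (hX : Set.InjOn X P)
    (he : IsConsecutive X Y P e) (hf : IsConsecutive X Y P f)
    (h : lineOf X Y e = lineOf X Y f) {x : ℚ} (hxe : x ∈ Set.Ioo (X e.1) (X e.2))
    (hxf : x ∈ Set.Ioo (X f.1) (X f.2)) : e = f := by
  have key : ∀ {e f : α × α}, IsConsecutive X Y P e → IsConsecutive X Y P f →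
      lineOf X Y e = lineOf X Y f → x ∈ Set.Ioo (X e.1) (X e.2) →
      x ∈ Set.Ioo (X f.1) (X f.2) → X f.1 ≤ X e.1 ∧ X e.2 ≤ X f.2 := by
    intro e f he hf h hxe hxf
    constructor
    · by_contra! hlt
      have := he.not_between f.1 hf.mem_fst (h ▸ onLine_fst f) hlt
      linarith [hxe.2, hxf.1]
    · exact he.not_between f.2 hf.mem_snd (h ▸ onLine_snd hf.lt.ne)
        (hxe.1.trans hxf.2)
  have h1 := key he hf h hxe hxf
  have h2 := key hf he h.symm hxf hxe
  exact Prod.ext (hX he.mem_fst hf.mem_fst (le_antisymm h2.1 h1.1))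
    (hX he.mem_snd hf.mem_snd (le_antisymm h1.2 h2.2))

lemma IsConsecutive.eq_of_slope_eq {e f : α × α} (hX : Set.InjOn X P)
    (he : IsConsecutive X Y P e) (hf : IsConsecutive X Y P f) (h : e.1 = f.1)
    (hs : slope X Y e = slope X Y f) : e = f := by
  have hl : lineOf X Y e = lineOf X Y f := by
    simp only [lineOf, ordinate, hs, h]
  refine Prod.ext h (hX he.mem_snd hf.mem_snd (le_antisymm ?_ ?_))
  · exact he.not_between f.2 hf.mem_snd (hl ▸ onLine_snd hf.lt.ne) (h ▸ hf.lt)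
  · exact hf.not_between e.2 he.mem_snd (hl ▸ onLine_snd he.lt.ne) (h ▸ he.lt)

lemma Crosses.exists_mem_Ioo {e f : α × α} (h : Crosses X Y e f) :
    (lineOf X Y e).1 ≠ (lineOf X Y f).1 ∧
    ∃ x, x ∈ Set.Ioo (X e.1) (X e.2) ∧ x ∈ Set.Ioo (X f.1) (X f.2) ∧
      x = ((lineOf X Y f).2 - (lineOf X Y e).2) / ((lineOf X Y e).1 - (lineOf X Y f).1) := by
  obtain ⟨x₀, x₁, h0e, h0f, h1e, h1f, h0, h1⟩ := h
  simp only [ordinate_eq] at h0 h1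
  generalize lineOf X Y e = l at *
  generalize lineOf X Y f = m at *
  have hne : l.1 - m.1 ≠ 0 := fun h => by
    rw [sub_eq_zero] at h
    rw [h] at h0 h1
    linarith
  have hx : (m.2 - l.2) / (l.1 - m.1) * (l.1 - m.1) = m.2 - l.2 := div_mul_cancel₀ _ hne
  refine ⟨sub_ne_zero.1 hne, _, ?_, ?_, rfl⟩ <;>
  generalize (m.2 - l.2) / (l.1 - m.1) = x at * <;>
  rcases lt_or_gt_of_ne hne with h | h
  all_goals
    obtain ⟨ha, hb⟩ | ⟨ha, hb⟩ : x₀ < x ∧ x < x₁ ∨ x₁ < x ∧ x < x₀ := by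
      first
        | exact Or.inl ⟨by nlinarith, by nlinarith⟩
        | exact Or.inr ⟨by nlinarith, by nlinarith⟩
    · constructor <;> linarith [h0e.1, h0e.2, h0f.1, h0f.2, h1e.1, h1e.2, h1f.1, h1f.2]
    · constructor <;> linarith [h0e.1, h0e.2, h0f.1, h0f.2, h1e.1, h1e.2, h1f.1, h1f.2]

open Classical in
lemma card_crossings_le {E : Finset (α × α)} (hX : Set.InjOn X P)
    (hE : ∀ e ∈ E, IsConsecutive X Y P e ∧ lineOf X Y e ∈ L) :
    ((E ×ˢ E).filter fun c => Crosses X Y c.1 c.2).card ≤ L.card * L.card := by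
  rw [← Finset.card_product]
  refine Finset.card_le_card_of_injOn (fun c => (lineOf X Y c.1, lineOf X Y c.2)) ?_ ?_
  · intro c hc
    simp only [Finset.coe_filter, Finset.mem_product, Set.mem_ofPred_eq] at hc
    simp [(hE _ hc.1.1).2, (hE _ hc.1.2).2]
  · intro c hc d hd hcd
    simp only [Finset.coe_filter, Finset.mem_product, Set.mem_ofPred_eq] at hc hd
    obtain ⟨h1, h2⟩ := Prod.ext_iff.1 hcd
    simp only at h1 h2
    obtain ⟨-, x, hx1, hx2, hx⟩ := hc.2.exists_mem_Ioo
    obtain ⟨-, y, hy1, hy2, hy⟩ := hd.2.exists_mem_Ioo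
    rw [h1, h2, ← hy] at hx
    subst hx
    exact Prod.ext ((hE _ hc.1.1).1.eq_of_mem_Ioo hX (hE _ hd.1.1).1 h1 hx1 hy1)
      ((hE _ hc.1.2).1.eq_of_mem_Ioo hX (hE _ hd.1.2).1 h2 hx2 hy2)

open Classical in
lemma card_onLine_le (hX : Set.InjOn X P) (l : ℚ × ℚ) :
    (P.filter fun p => OnLine X Y p l).card ≤
      1 + ((P ×ˢ P).filter fun e => IsConsecutive X Y P e ∧ lineOf X Y e = l).card := by
  rcases (P.filter fun p => OnLine X Y p l).eq_empty_or_nonempty with h | h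
  · simp [h]
  obtain ⟨m, hm, hmax⟩ := Finset.exists_max_image _ X h
  rw [← Finset.card_erase_add_one hm, add_comm]
  refine Nat.add_le_add_left ((Finset.card_le_card (t := Finset.image Prod.fst _) ?_).trans
    Finset.card_image_le) 1
  intro p hp
  obtain ⟨hpm, hp⟩ := Finset.mem_erase.1 hp
  have hp' := Finset.mem_filter.1 hp
  have hm' := Finset.mem_filter.1 hm
  have hlt : X p < X m := (hmax p hp).lt_of_ne fun h => hpm (hX hp'.1 hm'.1 h)
  obtain ⟨q, hq, hmin⟩ := Finset.exists_min_image
    (P.filter fun q => OnLine X Y q l ∧ X p < X q) X ⟨m, by simp [hm'.1, hm'.2, hlt]⟩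
  simp only [Finset.mem_filter] at hq hmin
  have hl := lineOf_eq hq.2.2.ne hp'.2 hq.2.1
  simp only [Finset.mem_image, Finset.mem_filter, Finset.mem_product]
  exact ⟨(p, q), ⟨⟨hp'.1, hq.1⟩, ⟨hp'.1, hq.1, hq.2.2, fun r hr h1 h2 =>
    hmin r ⟨hr, hl ▸ h1, h2⟩⟩, hl⟩, rfl⟩

open Classical in
/-- The Szemerédi–Trotter theorem. -/
theorem incidences_le (hX : Set.InjOn X P) {p m z : ℝ} (hz : 0 ≤ z) (hp : (P.card : ℝ) ≤ p)
    (hm : (L.card : ℝ) ≤ m) (h : (p * m) ^ 2 ≤ z ^ 3) :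
    (∑ l ∈ L, ((P.filter fun p => OnLine X Y p l).card : ℝ)) ≤ m + 6 * p + 5 * z := by
  set E := (P ×ˢ P).filter fun e => IsConsecutive X Y P e ∧ lineOf X Y e ∈ L with hE
  have hE' : ∀ e ∈ E, IsConsecutive X Y P e ∧ lineOf X Y e ∈ L := fun e he =>
    (Finset.mem_filter.1 he).2
  have h1 : ∑ l ∈ L, (P.filter fun p => OnLine X Y p l).card ≤ L.card + E.card := by
    rw [Finset.card_eq_sum_card_fiberwise (f := lineOf X Y) (s := E) (t := L)
      fun e he => (hE' e he).2, Finset.card_eq_sum_ones, ← Finset.sum_add_distrib]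
    refine Finset.sum_le_sum fun l hl => (card_onLine_le hX l).trans ?_
    refine Nat.add_le_add_left (Finset.card_le_card fun e he => ?_) 1
    simp only [hE, Finset.mem_filter] at he ⊢
    exact ⟨⟨he.1, he.2.1, he.2.2 ▸ hl⟩, he.2.2⟩
  have h2 := card_edges_le_or hX (E := E) (N := (L.card : ℝ) ^ 2)
    (fun e he => ⟨(hE' e he).1.mem_fst, (hE' e he).1.mem_snd, (hE' e he).1.lt⟩)
    (fun e he f hf => (hE' e he).1.eq_of_slope_eq hX (hE' f hf).1)
    (by rw [pow_two]; exact_mod_cast card_crossings_le hX hE')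
  have h3 : (∑ l ∈ L, ((P.filter fun p => OnLine X Y p l).card : ℝ)) ≤ L.card + E.card := by
    exact_mod_cast h1
  have hp0 : (0 : ℝ) ≤ P.card := Nat.cast_nonneg _
  have hm0 : (0 : ℝ) ≤ L.card := Nat.cast_nonneg _
  rcases h2 with h2 | h2
  · linarith
  have h4 : (E.card : ℝ) ≤ 5 * z := by
    refine le_of_pow_le_pow_left₀ (n := 3) (by norm_num) (by positivity) (h2.trans ?_)
    have : (P.card * L.card : ℝ) ^ 2 ≤ (p * m) ^ 2 :=
      pow_le_pow_left₀ (by positivity) (mul_le_mul hp hm hm0 (hp0.trans hp)) 2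
    nlinarith [pow_nonneg hz 3]
  linarith

end SzemerediTrotter

section RichLines

variable {α : Type*} (X Y : α → ℚ)

open Classical in
/-- The points of `B` on the line `l`. -/
noncomputable def ptsOn (B : Finset α) (l : ℚ × ℚ) : Finset α := B.filter fun p => OnLine X Y p l

open Classical in
/-- The lines spanned by `B` containing at least `k` points of `B`. -/
noncomputable def richLines (B : Finset α) (k : ℕ) : Finset (ℚ × ℚ) :=
  (((B ×ˢ B).filter fun e => X e.1 ≠ X e.2).image (lineOf X Y)).filter
    fun l => k ≤ (ptsOn X Y B l).card

variable {X Y} {A B : Finset α}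

lemma mem_ptsOn {p : α} {l : ℚ × ℚ} : p ∈ ptsOn X Y B l ↔ p ∈ B ∧ OnLine X Y p l := by
  classical
  exact Finset.mem_filter

lemma mem_richLines (hX : Set.InjOn X B) {k : ℕ} (hk : 2 ≤ k) {l : ℚ × ℚ} :
    l ∈ richLines X Y B k ↔ k ≤ (ptsOn X Y B l).card := by
  classical
  simp only [richLines, Finset.mem_filter, Finset.mem_image, and_iff_right_iff_imp]
  intro h
  obtain ⟨p, hp, q, hq, hpq⟩ := Finset.one_lt_card.1 (lt_of_lt_of_le hk h)
  rw [mem_ptsOn] at hp hq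
  have hne : X p ≠ X q := fun h => hpq (hX hp.1 hq.1 h)
  exact ⟨(p, q), ⟨Finset.mem_product.2 ⟨hp.1, hq.1⟩, hne⟩, lineOf_eq hne hp.2 hq.2⟩

lemma sum_ptsOn_le (hX : Set.InjOn X A) {L : Finset (ℚ × ℚ)} {p m z : ℝ} (hz : 0 ≤ z)
    (hp : (A.card : ℝ) ≤ p) (hm : (L.card : ℝ) ≤ m) (h : (p * m) ^ 2 ≤ z ^ 3) :
    ∑ l ∈ L, ((ptsOn X Y A l).card : ℝ) ≤ m + 6 * p + 5 * z :=
  incidences_le hX hz hp hm h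

lemma card_richLines_le_or (hX : Set.InjOn X B) {b : ℝ} (hB : (B.card : ℝ) ≤ b) {k : ℕ}
    (hk : 2 ≤ k) :
    ((richLines X Y B k).card : ℝ) * k ≤ 24 * b ∨
      ((richLines X Y B k).card : ℝ) * k ^ 3 ≤ 8000 * b ^ 2 := by
  set m : ℝ := ((richLines X Y B k).card : ℝ)
  have hb : 0 ≤ b := (Nat.cast_nonneg _).trans hB
  have hm : 0 ≤ m := Nat.cast_nonneg _
  have hk' : (2 : ℝ) ≤ k := by exact_mod_cast hk
  obtain ⟨z, hz, hz3⟩ : ∃ z : ℝ, 0 ≤ z ∧ z ^ 3 = (b * m) ^ 2 :=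
    ⟨((b * m) ^ 2) ^ ((3 : ℕ) : ℝ)⁻¹, by positivity,
      Real.rpow_inv_natCast_pow (by positivity) (by norm_num)⟩
  have h1 := sum_ptsOn_le (Y := Y) hX hz hB (le_refl m) hz3.ge
  have h2 : m * k ≤ ∑ l ∈ richLines X Y B k, ((ptsOn X Y B l).card : ℝ) := by
    rw [← nsmul_eq_mul]
    refine Finset.card_nsmul_le_sum _ _ _ fun l hl => ?_
    exact_mod_cast (mem_richLines hX hk).1 hl
  by_cases h3 : m * k ≤ 24 * b
  · exact Or.inl h3
  right
  have h4 : m * k ≤ 20 * z := by nlinarith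
  have h5 : (m * k) ^ 3 ≤ (20 * z) ^ 3 := pow_le_pow_left₀ (by positivity) h4 3
  rw [mul_pow 20 z, hz3] at h5
  have hm' : 0 < m := hm.lt_of_ne fun h => by
    rw [← h] at h3
    simp only [zero_mul] at h3
    exact h3 (by positivity)
  have h6 : m ^ 2 * (m * k ^ 3) ≤ m ^ 2 * (8000 * b ^ 2) := by nlinarith
  exact le_of_mul_le_mul_left h6 (by positivity)

lemma card_richLines_le (hX : Set.InjOn X B) {b : ℝ} (hB : (B.card : ℝ) ≤ b) {k : ℕ}
    (hk : 2 ≤ k) (hkb : (k : ℝ) ^ 2 ≤ b) :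
    ((richLines X Y B k).card : ℝ) ≤ 8000 * b ^ 2 / k ^ 3 := by
  have hk' : (0 : ℝ) < k := by positivity
  rw [le_div_iff₀ (by positivity)]
  rcases card_richLines_le_or (Y := Y) hX hB hk with h | h
  · have : ((richLines X Y B k).card : ℝ) * k ^ 3 ≤ 24 * b * k ^ 2 := by
      nlinarith [sq_nonneg (k : ℝ)]
    nlinarith
  · exact h

/-- Lines containing more than `√b` points of a set of size at most `b` have `O(b)` incidences
with this set. -/
lemma sum_ptsOn_richLines_le (hX : Set.InjOn X B) {b : ℝ} (hb : 1 ≤ b) (hB : (B.card : ℝ) ≤ b)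
    {k : ℕ} (hk : 2 ≤ k) (hkb : b ≤ (k : ℝ) ^ 2) :
    ∑ l ∈ richLines X Y B k, ((ptsOn X Y B l).card : ℝ) ≤ 11000 * b := by
  have hs0 : 0 < √b := Real.sqrt_pos.2 (by linarith)
  have hss : √b * √b = b := Real.mul_self_sqrt (by linarith)
  have hsk : √b ≤ k := (Real.sqrt_le_left (by positivity)).2 hkb
  have hs1 : √b ≤ b := by nlinarith [Real.one_le_sqrt.2 hb]
  have hm : ((richLines X Y B k).card : ℝ) ≤ 8000 * √b := by
    have hm0 : (0 : ℝ) ≤ (richLines X Y B k).card := Nat.cast_nonneg _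
    rcases card_richLines_le_or (Y := Y) hX hB hk with h | h
    · have := (mul_le_mul_of_nonneg_left hsk hm0).trans h
      nlinarith
    · have h3 : √b ^ 3 ≤ (k : ℝ) ^ 3 := pow_le_pow_left₀ hs0.le hsk 3
      have := (mul_le_mul_of_nonneg_left h3 hm0).trans h
      have h4 : (richLines X Y B k).card * √b ^ 3 ≤ (8000 * √b) * √b ^ 3 := by
        refine this.trans (le_of_eq ?_)
        rw [← hss, Real.sqrt_mul_self hs0.le]
        ring
      exact le_of_mul_le_mul_right h4 (by positivity)
  have := sum_ptsOn_le (Y := Y) hX (z := 400 * b) (by positivity) hB hm (le_of_eq (by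
    rw [mul_pow, mul_pow, pow_two √b, hss]; ring))
  linarith

lemma min_le_telescope {u r x : ℝ} (hu : 0 ≤ u) (hr : 0 < r) (hx : 0 < x) :
    min (u * x) (u * r ^ 2 / x) ≤ 6 * u * r * (2 * x / (2 * x + r) - x / (x + r)) := by
  have h : 2 * x / (2 * x + r) - x / (x + r) = r * x / ((2 * x + r) * (x + r)) := by
    field_simp
    ring
  rw [h]
  rcases le_total x r with hxr | hxr
  · refine (min_le_left _ _).trans ?_
    rw [← mul_div_assoc, le_div_iff₀ (by positivity)]
    have : (2 * x + r) * (x + r) ≤ 6 * r ^ 2 := by nlinarith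
    nlinarith [mul_le_mul_of_nonneg_left this (mul_nonneg hu hx.le)]
  · refine (min_le_right _ _).trans ?_
    rw [← mul_div_assoc, div_le_div_iff₀ hx (by positivity)]
    have : (2 * x + r) * (x + r) ≤ 6 * x ^ 2 := by nlinarith
    nlinarith [mul_le_mul_of_nonneg_left this (mul_nonneg hu (sq_nonneg r))]

lemma sum_min_le {u r : ℝ} (hu : 0 ≤ u) (hr : 0 < r) (M : ℕ) :
    ∑ s ∈ Finset.range M, min (u * 2 ^ s) (u * r ^ 2 / 2 ^ s) ≤ 6 * u * r := by
  have h : ∀ s ∈ Finset.range M, min (u * 2 ^ s) (u * r ^ 2 / 2 ^ s) ≤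
      6 * u * r * ((2 : ℝ) ^ (s + 1) / (2 ^ (s + 1) + r) - 2 ^ s / (2 ^ s + r)) := fun s _ => by
    rw [pow_succ' (2 : ℝ) s]
    exact min_le_telescope hu hr (pow_pos two_pos s)
  refine (Finset.sum_le_sum h).trans ?_
  rw [← Finset.mul_sum, Finset.sum_range_sub (fun s => (2 : ℝ) ^ s / (2 ^ s + r))]
  refine mul_le_of_le_one_right (by positivity) ?_
  have h1 : (2 : ℝ) ^ M / (2 ^ M + r) ≤ 1 := (div_le_one (by positivity)).2 (by linarith)
  have h2 : (0 : ℝ) ≤ 2 ^ 0 / (2 ^ 0 + r) := by positivity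
  linarith

end RichLines

section PoorPairs

variable {α : Type*} {X Y : α → ℚ} {A B : Finset α}

open Classical in
lemma card_pairs_le (hX : Set.InjOn X B) {D : Finset (α × α)} {s : ℕ} (hs : 1 ≤ s)
    (hD : ∀ e ∈ D, e.1 ∈ A ∧ e.2 ∈ B ∧ X e.1 ≠ X e.2 ∧
      2 ^ s ≤ (ptsOn X Y B (lineOf X Y e)).card ∧
      (ptsOn X Y B (lineOf X Y e)).card < 2 ^ (s + 1)) :
    (D.card : ℝ) ≤ 2 ^ (s + 1) * ∑ l ∈ richLines X Y B (2 ^ s), ((ptsOn X Y A l).card : ℝ) := by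
  have hk : 2 ≤ 2 ^ s := by
    calc 2 = 2 ^ 1 := rfl
      _ ≤ 2 ^ s := Nat.pow_le_pow_right (by norm_num) hs
  rw [Finset.card_eq_sum_card_fiberwise (f := lineOf X Y) (t := richLines X Y B (2 ^ s))
    fun e he => (mem_richLines hX hk).2 (hD e he).2.2.2.1]
  push_cast
  rw [Finset.mul_sum]
  refine Finset.sum_le_sum fun l hl => ?_
  rcases (D.filter fun e => lineOf X Y e = l).eq_empty_or_nonempty with h | ⟨e, he⟩
  · rw [h]
    simp only [Finset.card_empty, Nat.cast_zero]
    positivity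
  obtain ⟨heD, rfl⟩ := Finset.mem_filter.1 he
  have h1 : (D.filter fun f => lineOf X Y f = lineOf X Y e) ⊆
      ptsOn X Y A (lineOf X Y e) ×ˢ ptsOn X Y B (lineOf X Y e) := fun f hf => by
    obtain ⟨hfD, hfe⟩ := Finset.mem_filter.1 hf
    obtain ⟨h1, h2, h3, -⟩ := hD f hfD
    rw [Finset.mem_product, mem_ptsOn, mem_ptsOn, ← hfe]
    exact ⟨⟨h1, onLine_fst f⟩, h2, onLine_snd h3⟩
  have h2 := Finset.card_le_card h1
  rw [Finset.card_product, mul_comm] at h2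
  have h3 := h2.trans (Nat.mul_le_mul_right _ (hD e heD).2.2.2.2.le)
  exact_mod_cast h3

/-- The number of collinear triples `(p, q, r) ∈ A × B × B` on lines containing few points of
`B`. -/
theorem sum_ptsOn_poor_le (hXA : Set.InjOn X A) (hXB : Set.InjOn X B) {a b σ : ℝ} (ha : 0 < a)
    (hσ : 0 < σ) (hA : (A.card : ℝ) ≤ a) (hB : (B.card : ℝ) ≤ b) (hab : b = a * σ ^ 6) {M : ℕ}
    (hM : b < 4 ^ M) {D : Finset (α × α)}
    (hD : ∀ e ∈ D, e.1 ∈ A ∧ e.2 ∈ B ∧ X e.1 ≠ X e.2 ∧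
      ((ptsOn X Y B (lineOf X Y e)).card : ℝ) ^ 2 ≤ b) :
    ∑ e ∈ D, ((ptsOn X Y B (lineOf X Y e)).card : ℝ) ≤
      200000 * (a * b) * (M * σ ^ 2 + 1 + σ ^ 3) := by
  classical
  have hb : 0 < b := by rw [hab]; positivity
  set g : α × α → ℕ := fun e => (ptsOn X Y B (lineOf X Y e)).card with hg
  have hg1 : ∀ e ∈ D, g e ≠ 0 := fun e he => Finset.card_ne_zero_of_mem (a := e.2)
    (mem_ptsOn.2 ⟨(hD e he).2.1, onLine_snd (hD e he).2.2.1⟩)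
  have hpow : ∀ e ∈ D, (2 : ℝ) ^ Nat.log 2 (g e) ≤ g e := fun e he => by
    exact_mod_cast Nat.pow_log_le_self 2 (hg1 e he)
  have hlog : ∀ e ∈ D, (4 : ℝ) ^ Nat.log 2 (g e) ≤ b := fun e he => by
    refine le_trans ?_ (hD e he).2.2.2
    rw [show (4 : ℝ) = 2 ^ 2 by norm_num, pow_right_comm]
    exact pow_le_pow_left₀ (by positivity) (hpow e he) 2
  have hmaps : ∀ e ∈ D, Nat.log 2 (g e) ∈ Finset.range M := fun e he => by
    rw [Finset.mem_range]
    by_contra! h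
    exact absurd ((hM.trans_le (pow_le_pow_right₀ (by norm_num) h)).trans_le (hlog e he))
      (lt_irrefl _)
  rw [← Finset.sum_fiberwise_of_maps_to hmaps]
  have hcard : (D.card : ℝ) ≤ a * b := by
    have : D ⊆ A ×ˢ B := fun e he => Finset.mem_product.2 ⟨(hD e he).1, (hD e he).2.1⟩
    have := Finset.card_le_card this
    rw [Finset.card_product] at this
    refine le_trans (by exact_mod_cast this) (mul_le_mul hA hB (Nat.cast_nonneg _) ha.le)
  have hbound : ∀ s ∈ Finset.range M, ∑ e ∈ D with Nat.log 2 (g e) = s, (g e : ℝ) ≤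
      min (32000 * (a * b) * 2 ^ s) (32000 * (a * b) * (σ ^ 3) ^ 2 / 2 ^ s) +
        (if (4 : ℝ) ^ s ≤ b then 24 * a * 4 ^ s else 0) + 8000 * (a * b) * σ ^ 2
        + if s = 0 then 2 * (a * b) else 0 := by
    intro s _
    set Ds := D.filter fun e => Nat.log 2 (g e) = s with hDs
    have hlt : ∀ e ∈ Ds, g e < 2 ^ (s + 1) := fun e he => by
      obtain ⟨-, rfl⟩ := Finset.mem_filter.1 he
      exact Nat.lt_pow_succ_log_self (by norm_num) _
    have h1 : ∑ e ∈ Ds, (g e : ℝ) ≤ Ds.card * 2 ^ (s + 1) := by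
      rw [← nsmul_eq_mul]
      refine Finset.sum_le_card_nsmul _ _ _ fun e he => ?_
      exact_mod_cast (hlt e he).le
    have h2 : (Ds.card : ℝ) ≤ a * b :=
      le_trans (by exact_mod_cast Finset.card_filter_le _ _) hcard
    have hnn : 0 ≤ min (32000 * (a * b) * 2 ^ s) (32000 * (a * b) * (σ ^ 3) ^ 2 / 2 ^ s) := by
      positivity
    have hnn2 : 0 ≤ (if (4 : ℝ) ^ s ≤ b then 24 * a * 4 ^ s else 0) := by positivity
    have hnn3 : 0 ≤ 8000 * (a * b) * σ ^ 2 := by positivity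
    rcases Nat.eq_zero_or_pos s with rfl | hs
    · simp only [if_true]
      simp only [zero_add, pow_one] at h1
      refine le_trans ?_ (le_add_of_nonneg_left (add_nonneg (add_nonneg hnn hnn2) hnn3))
      linarith
    rw [if_neg hs.ne', add_zero]
    rcases Ds.eq_empty_or_nonempty with h0 | ⟨e0, he0⟩
    · rw [h0, Finset.sum_empty]
      positivity
    have h4b : (4 : ℝ) ^ s ≤ b := by
      obtain ⟨heD, hes⟩ := Finset.mem_filter.1 he0
      rw [← hes]
      exact hlog e0 heD
    rw [if_pos h4b]
    have hk : 2 ≤ 2 ^ s := by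
      calc 2 = 2 ^ 1 := rfl
        _ ≤ 2 ^ s := Nat.pow_le_pow_right (by norm_num) hs
    have h3 := card_richLines_le (Y := Y) hXB hB hk (by
      push_cast
      rw [pow_right_comm]
      norm_num
      exact h4b)
    push_cast at h3
    have h4 : (4 : ℝ) ^ s = (2 ^ s) ^ 2 := by rw [pow_right_comm]; norm_num
    set x : ℝ := 2 ^ s with hx
    have hx0 : 0 < x := by positivity
    have h5 := sum_ptsOn_le (Y := Y) hXA (z := 400 * (a * b) * σ ^ 2 / x ^ 2) (by positivity) hA h3
      (le_of_eq (by rw [hab]; field_simp; ring))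
    have h6 := card_pairs_le (Y := Y) (A := A) hXB (D := Ds) hs fun e he => by
      obtain ⟨heD, hes⟩ := Finset.mem_filter.1 he
      refine ⟨(hD e heD).1, (hD e heD).2.1, (hD e heD).2.2.1, ?_, hlt e he⟩
      rw [← hes]
      exact Nat.pow_log_le_self 2 (hg1 e heD)
    rw [h4]
    rw [pow_succ, ← hx] at h1 h6
    have h7 : ∑ e ∈ Ds, (g e : ℝ) ≤ (32000 * (a * b) * (σ ^ 3) ^ 2 / x) + 24 * a * x ^ 2 +
        8000 * (a * b) * σ ^ 2 := by
      calc ∑ e ∈ Ds, (g e : ℝ) ≤ (x * 2 * (8000 * b ^ 2 / x ^ 3 + 6 * a +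
            5 * (400 * (a * b) * σ ^ 2 / x ^ 2))) * (x * 2) :=
          h1.trans (mul_le_mul_of_nonneg_right
            (h6.trans (mul_le_mul_of_nonneg_left h5 (by positivity))) (by positivity))
        _ = 32000 * b * b / x + 24 * a * x ^ 2 + 8000 * (a * b) * σ ^ 2 := by
          field_simp
          ring
        _ = _ := by
          rw [show 32000 * b * b = 32000 * (a * b) * (σ ^ 3) ^ 2 by
            nth_rewrite 1 [hab]
            ring]
    rcases min_cases (32000 * (a * b) * x) (32000 * (a * b) * (σ ^ 3) ^ 2 / x) with hm | hm
    · rw [hm.1]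
      have : (Ds.card : ℝ) * (x * 2) ≤ a * b * (x * 2) :=
        mul_le_mul_of_nonneg_right h2 (by positivity)
      have h8 : 0 ≤ a * b * x := by positivity
      have h9 : 0 ≤ 24 * a * x ^ 2 := by positivity
      linarith
    · rw [hm.1]
      linarith
  refine (Finset.sum_le_sum hbound).trans ?_
  simp only [Finset.sum_add_distrib]
  have hgeo : ∑ s ∈ Finset.range M, (if (4 : ℝ) ^ s ≤ b then 24 * a * 4 ^ s else 0) ≤
      32 * (a * b) := by
    have : ∀ M : ℕ, ∑ s ∈ Finset.range M, (if (4 : ℝ) ^ s ≤ b then 24 * a * 4 ^ s else 0) ≤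
        32 * (a * min b (4 ^ M / 4)) := by
      intro M
      induction M with
      | zero => simp; positivity
      | succ n ih =>
        rw [Finset.sum_range_succ]
        split_ifs with h
        · have h1 := min_le_right b ((4 : ℝ) ^ n / 4)
          rw [pow_succ, mul_div_assoc, div_self (by norm_num), mul_one, min_eq_right h]
          nlinarith
        · rw [add_zero]
          refine ih.trans ?_
          gcongr
          · norm_num
          · omega
    exact (this M).trans (by gcongr; exact min_le_left _ _)
  have h1 := sum_min_le (u := 32000 * (a * b)) (r := σ ^ 3) (by positivity) (by positivity) M
  have h2 : ∑ s ∈ Finset.range M, (if s = 0 then 2 * (a * b) else 0) ≤ 2 * (a * b) := by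
    rw [Finset.sum_ite_eq']
    split_ifs
    · exact le_rfl
    · positivity
  rw [Finset.sum_const, Finset.card_range, nsmul_eq_mul]
  have h3 : 0 ≤ a * b * (M * σ ^ 2) := by positivity
  have h4 : 0 ≤ a * b * σ ^ 3 := by positivity
  have h5 : 0 ≤ a * b := by positivity
  nlinarith

end PoorPairs

section LevelSum

lemma sum_pow_le {y : ℝ} (hy : 5 / 4 ≤ y) (n : ℕ) : ∑ j ∈ Finset.range n, y ^ j ≤ 4 * y ^ n := by
  induction n with
  | zero => simp
  | succ n ih =>
    rw [Finset.sum_range_succ, pow_succ]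
    have : 0 < y ^ n := by positivity
    nlinarith

/-- The normalized bound for the number of collinear triples between levels `i` and `j`. -/
noncomputable def levelBound (ρ : ℝ) (m i j : ℕ) : ℝ :=
  m * (ρ ^ j / ρ ^ i) ^ 2 + 1 + (ρ ^ j / ρ ^ i) ^ 3

variable {ρ : ℝ} {m : ℕ}

lemma levelBound_nonneg (hρ : 0 < ρ) (i j : ℕ) : 0 ≤ levelBound ρ m i j := by
  unfold levelBound; positivity

lemma one_le_of_pow_six (hρ : 0 < ρ) (hρ6 : ρ ^ 6 = 2) : 1 ≤ ρ := by
  by_contra! h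
  have := pow_le_one₀ (n := 6) hρ.le h.le
  linarith

lemma five_fourths_le_sq (hρ6 : ρ ^ 6 = 2) : 5 / 4 ≤ ρ ^ 2 := by
  by_contra! h
  have := pow_lt_pow_left₀ h (by positivity) (n := 3) (by norm_num)
  rw [← pow_mul, hρ6] at this
  norm_num at this

lemma sum_levelBound_le (hρ : 0 < ρ) (hρ6 : ρ ^ 6 = 2) (i : ℕ) {j : ℕ} (hj : j < m) :
    ∑ k ∈ Finset.range m, (if k ≤ j then levelBound ρ m i k else 0) ≤
      8 * m * (ρ ^ j / ρ ^ i) ^ 2 + m + 8 * (ρ ^ j / ρ ^ i) ^ 3 := by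
  have h1 := one_le_of_pow_six hρ hρ6
  have h2 := five_fourths_le_sq hρ6
  have h3 : 5 / 4 ≤ ρ ^ 3 := h2.trans (pow_le_pow_right₀ h1 (by norm_num))
  have h2' : ρ ^ 2 ≤ 2 := hρ6 ▸ pow_le_pow_right₀ h1 (by norm_num)
  have h3' : ρ ^ 3 ≤ 2 := hρ6 ▸ pow_le_pow_right₀ h1 (by norm_num)
  have key : ∀ n : ℕ, 5 / 4 ≤ ρ ^ n → ρ ^ n ≤ 2 →
      ∑ k ∈ Finset.range (j + 1), (ρ ^ k / ρ ^ i) ^ n ≤ 8 * (ρ ^ j / ρ ^ i) ^ n := by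
    intro n hn hn'
    have : ∀ k, (ρ ^ k / ρ ^ i) ^ n = (ρ ^ n) ^ k / (ρ ^ i) ^ n := fun k => by
      rw [div_pow, pow_right_comm]
    simp only [this]
    rw [← Finset.sum_div, ← mul_div_assoc]
    refine div_le_div_of_nonneg_right ((sum_pow_le hn _).trans ?_) (by positivity)
    rw [pow_succ]
    have : 0 < (ρ ^ n) ^ j := by positivity
    nlinarith
  rw [← Finset.sum_filter, show (Finset.range m).filter (fun k => k ≤ j) = Finset.range (j + 1) by
    ext k; simp only [Finset.mem_filter, Finset.mem_range]; omega]
  simp only [levelBound, Finset.sum_add_distrib, ← Finset.mul_sum, Finset.sum_const,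
    Finset.card_range, nsmul_eq_mul, mul_one]
  have h4 := mul_le_mul_of_nonneg_left (key 2 h2 h2') (Nat.cast_nonneg (α := ℝ) m)
  have h5 : ((j + 1 : ℕ) : ℝ) ≤ m := by exact_mod_cast hj
  have h6 := key 3 h3 h3'
  linarith

lemma sum_levelBound_mul_le (hρ : 0 < ρ) (hρ6 : ρ ^ 6 = 2) {j : ℕ} (hj : j < m) :
    ∑ i ∈ Finset.range m, ∑ k ∈ Finset.range m, (if i < j ∧ k ≤ j then
      (ρ ^ i / ρ ^ j) ^ 6 * (levelBound ρ m i j * levelBound ρ m i k) else 0) ≤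
      (18 * m) ^ 2 := by
  have h1 := one_le_of_pow_six hρ hρ6
  have h2 := five_fourths_le_sq hρ6
  have hm : (1 : ℝ) ≤ m := by exact_mod_cast (by omega : 1 ≤ m)
  have hrow : ∀ i ∈ Finset.range m, ∑ k ∈ Finset.range m, (if i < j ∧ k ≤ j then
      (ρ ^ i / ρ ^ j) ^ 6 * (levelBound ρ m i j * levelBound ρ m i k) else 0) ≤
      if i < j then 72 * m ^ 2 * ((ρ ^ 2) ^ i / (ρ ^ 2) ^ j) + 18 else 0 := by
    intro i _
    by_cases hij : i < j
    · simp only [hij, true_and, if_true]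
      have : ∑ k ∈ Finset.range m, (if k ≤ j then
          (ρ ^ i / ρ ^ j) ^ 6 * (levelBound ρ m i j * levelBound ρ m i k) else 0) =
          (ρ ^ i / ρ ^ j) ^ 6 * (levelBound ρ m i j *
            ∑ k ∈ Finset.range m, (if k ≤ j then levelBound ρ m i k else 0)) := by
        rw [Finset.mul_sum, Finset.mul_sum]
        simp only [mul_ite, mul_zero]
      rw [this]
      have hσ : 1 ≤ ρ ^ j / ρ ^ i := (one_le_div (by positivity)).2 (pow_le_pow_right₀ h1 hij.le)
      have hinv : ρ ^ i / ρ ^ j = (ρ ^ j / ρ ^ i)⁻¹ := (inv_div _ _).symm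
      have hsum := sum_levelBound_le hρ hρ6 i hj
      have hinv2 : (ρ ^ 2) ^ i / (ρ ^ 2) ^ j = ((ρ ^ j / ρ ^ i) ^ 2)⁻¹ := by
        rw [← inv_pow, ← hinv, div_pow, pow_right_comm ρ 2 i, pow_right_comm ρ 2 j]
      rw [hinv, hinv2]
      unfold levelBound at hsum ⊢
      generalize ρ ^ j / ρ ^ i = σ at *
      have hσ2 : (m : ℝ) ≤ m * σ ^ 2 := le_mul_of_one_le_right (by linarith) (one_le_pow₀ hσ)
      have e1 : (m : ℝ) * σ ^ 2 + 1 + σ ^ 3 ≤ 2 * m * σ ^ 2 + σ ^ 3 := by linarith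
      have e2 : 8 * (m : ℝ) * σ ^ 2 + m + 8 * σ ^ 3 ≤ 9 * (2 * m * σ ^ 2 + σ ^ 3) := by
        have : 0 ≤ σ ^ 3 := by positivity
        nlinarith
      calc _ ≤ σ⁻¹ ^ 6 * ((2 * m * σ ^ 2 + σ ^ 3) * (9 * (2 * m * σ ^ 2 + σ ^ 3))) := by
            refine mul_le_mul_of_nonneg_left (mul_le_mul e1 (hsum.trans e2) ?_ ?_) ?_
            · refine Finset.sum_nonneg fun k _ => ?_
              split_ifs
              · exact levelBound_nonneg hρ _ _
              · exact le_rfl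
            · positivity
            · positivity
        _ ≤ σ⁻¹ ^ 6 * (72 * m ^ 2 * σ ^ 4 + 18 * σ ^ 6) := by
            refine mul_le_mul_of_nonneg_left ?_ (by positivity)
            nlinarith [sq_nonneg (2 * m * σ ^ 2 - σ ^ 3)]
        _ = _ := by
            field_simp
    · simp [hij]
  refine (Finset.sum_le_sum hrow).trans ?_
  rw [← Finset.sum_filter, show (Finset.range m).filter (fun k => k < j) = Finset.range j by
    ext k; simp only [Finset.mem_filter, Finset.mem_range]; omega]
  rw [Finset.sum_add_distrib, ← Finset.mul_sum, ← Finset.sum_div, Finset.sum_const,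
    Finset.card_range, nsmul_eq_mul]
  have h3 : (∑ i ∈ Finset.range j, (ρ ^ 2) ^ i) / (ρ ^ 2) ^ j ≤ 4 := by
    rw [div_le_iff₀ (by positivity)]
    exact sum_pow_le h2 j
  have h4 : (j : ℝ) ≤ m := by exact_mod_cast hj.le
  have h5 := mul_le_mul_of_nonneg_left h3 (by positivity : (0 : ℝ) ≤ 72 * m ^ 2)
  nlinarith

/-- Summation over the levels of the vertices of right-angled corners. -/
lemma sum_levels_le (hρ : 0 < ρ) (hρ6 : ρ ^ 6 = 2) {F : ℕ → ℝ} (hF : ∀ i, 0 ≤ F i) :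
    ∑ i ∈ Finset.range m, ∑ j ∈ Finset.range m, ∑ k ∈ Finset.range m,
      F i * F j * F k * F (max i (max j k)) *
        (√(2 ^ (i + j) * levelBound ρ m i j) * √(2 ^ (i + k) * levelBound ρ m i k)) ≤
      53 * m * (∑ i ∈ Finset.range m, 2 ^ i * F i ^ 2) ^ 2 := by
  set s : ℕ → ℕ → ℝ := fun i j => √(levelBound ρ m i j) with hs
  set l : ℕ → ℝ := fun i => ρ ^ (3 * i) * F i with hl
  have hl0 : ∀ i, 0 ≤ l i := fun i => mul_nonneg (by positivity) (hF i)
  have hs0 : ∀ i j, 0 ≤ s i j := fun i j => Real.sqrt_nonneg _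
  have hs2 : ∀ i j, s i j ^ 2 = levelBound ρ m i j := fun i j =>
    Real.sq_sqrt (levelBound_nonneg hρ i j)
  have h2 : ∀ i, (2 : ℝ) ^ i = (ρ ^ (3 * i)) ^ 2 := fun i => by
    rw [← hρ6, ← pow_mul, ← pow_mul]; congr 1; ring
  have hsq : ∀ i j, √(2 ^ (i + j) * levelBound ρ m i j) = ρ ^ (3 * i) * ρ ^ (3 * j) * s i j := by
    intro i j
    rw [Real.sqrt_mul (by positivity), h2, Real.sqrt_sq (by positivity), mul_add, pow_add]
  have hΛ : ∑ i ∈ Finset.range m, 2 ^ i * F i ^ 2 = ∑ i ∈ Finset.range m, l i ^ 2 :=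
    Finset.sum_congr rfl fun i _ => by rw [h2, hl]; ring
  rw [hΛ]
  set Λ := ∑ i ∈ Finset.range m, l i ^ 2 with hΛdef
  have hΛ0 : 0 ≤ Λ := Finset.sum_nonneg fun i _ => sq_nonneg _
  set c : ℕ → ℕ → ℝ := fun i j => if j ≤ i then s i j else 0 with hc
  set g : ℕ → ℕ → ℕ → ℝ := fun i j k =>
    if i < j ∧ k ≤ j then (ρ ^ i / ρ ^ j) ^ 3 * (s i j * s i k) else 0 with hg
  have hg0 : ∀ i j k, 0 ≤ g i j k := fun i j k => by
    simp only [hg]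
    split_ifs
    · exact mul_nonneg (by positivity) (mul_nonneg (hs0 _ _) (hs0 _ _))
    · exact le_rfl
  have hc0 : ∀ i j, 0 ≤ c i j := fun i j => by
    simp only [hc]
    split_ifs
    · exact hs0 _ _
    · exact le_rfl
  have hterm : ∀ i j k, F i * F j * F k * F (max i (max j k)) *
      (√(2 ^ (i + j) * levelBound ρ m i j) * √(2 ^ (i + k) * levelBound ρ m i k)) ≤
      l i ^ 2 * ((l j * c i j) * (l k * c i k)) + l j ^ 2 * ((l i * l k) * g i j k) +
        l k ^ 2 * ((l i * l j) * g i k j) := by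
    intro i j k
    have ha : 0 ≤ l i ^ 2 * ((l j * c i j) * (l k * c i k)) :=
      mul_nonneg (sq_nonneg _) (mul_nonneg (mul_nonneg (hl0 _) (hc0 _ _))
        (mul_nonneg (hl0 _) (hc0 _ _)))
    have hb : ∀ j k, 0 ≤ l j ^ 2 * ((l i * l k) * g i j k) := fun j k =>
      mul_nonneg (sq_nonneg _) (mul_nonneg (mul_nonneg (hl0 _) (hl0 _)) (hg0 _ _ _))
    have hb1 := hb j k
    have hb2 := hb k j
    have hpow : ∀ i : ℕ, 0 < ρ ^ i := fun i => by positivity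
    rw [hsq, hsq]
    rcases le_total k j with hkj | hkj
    · rcases le_or_gt j i with hji | hji
      · refine le_trans (le_of_eq ?_) ((le_add_of_nonneg_right hb1).trans
          (le_add_of_nonneg_right hb2))
        rw [max_eq_left (max_le hji (hkj.trans hji))]
        simp only [hc, hji, hkj.trans hji, if_true, hl]
        ring
      · refine le_trans (le_of_eq ?_) ((le_add_of_nonneg_left ha).trans
          (le_add_of_nonneg_right hb2))
        rw [max_eq_left hkj, max_eq_right hji.le]
        simp only [hg, hji, hkj, and_self, if_true, hl]
        have := (hpow j).ne'
        rw [pow_mul', pow_mul', pow_mul']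
        field_simp
    · rcases le_or_gt k i with hji | hji
      · refine le_trans (le_of_eq ?_) ((le_add_of_nonneg_right hb1).trans
          (le_add_of_nonneg_right hb2))
        rw [max_eq_left (max_le (hkj.trans hji) hji)]
        simp only [hc, hji, hkj.trans hji, if_true, hl]
        ring
      · refine le_trans (le_of_eq ?_) (le_add_of_nonneg_left (add_nonneg ha hb1))
        rw [max_eq_right hkj, max_eq_right hji.le]
        simp only [hg, hji, hkj, and_self, if_true, hl]
        have := (hpow k).ne'
        rw [pow_mul', pow_mul', pow_mul']
        field_simp
  have hA : ∑ i ∈ Finset.range m, ∑ j ∈ Finset.range m, ∑ k ∈ Finset.range m,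
      l i ^ 2 * ((l j * c i j) * (l k * c i k)) ≤ 17 * m * Λ ^ 2 := by
    have : ∀ i ∈ Finset.range m, ∑ j ∈ Finset.range m, ∑ k ∈ Finset.range m,
        l i ^ 2 * ((l j * c i j) * (l k * c i k)) ≤ l i ^ 2 * (Λ * (17 * m)) := by
      intro i hi
      simp only [← Finset.mul_sum]
      rw [← Finset.sum_mul, ← pow_two]
      refine mul_le_mul_of_nonneg_left ((Finset.sum_mul_sq_le_sq_mul_sq _ _ _).trans
        (mul_le_mul_of_nonneg_left ?_ hΛ0)) (sq_nonneg _)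
      have h3 := sum_levelBound_le hρ hρ6 i (Finset.mem_range.1 hi)
      rw [div_self (by positivity)] at h3
      have hm : (1 : ℝ) ≤ m := by
        exact_mod_cast (Nat.zero_lt_of_lt (Finset.mem_range.1 hi))
      refine (le_of_eq (Finset.sum_congr rfl fun j _ => ?_)).trans (h3.trans (by linarith))
      simp only [hc]
      split_ifs
      · exact hs2 i j
      · simp
    refine (Finset.sum_le_sum this).trans (le_of_eq ?_)
    rw [← Finset.sum_mul]
    ring
  have hB : ∑ j ∈ Finset.range m, ∑ i ∈ Finset.range m, ∑ k ∈ Finset.range m,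
      l j ^ 2 * ((l i * l k) * g i j k) ≤ 18 * m * Λ ^ 2 := by
    have : ∀ j ∈ Finset.range m, ∑ i ∈ Finset.range m, ∑ k ∈ Finset.range m,
        l j ^ 2 * ((l i * l k) * g i j k) ≤ l j ^ 2 * (Λ * (18 * m)) := by
      intro j hj
      simp only [← Finset.mul_sum]
      refine mul_le_mul_of_nonneg_left ?_ (sq_nonneg _)
      rw [← Finset.sum_product']
      refine le_of_pow_le_pow_left₀ (n := 2) (by norm_num) (by positivity) ?_
      refine (Finset.sum_mul_sq_le_sq_mul_sq _ _ _).trans ?_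
      rw [mul_pow]
      refine mul_le_mul (le_of_eq ?_) ?_ (Finset.sum_nonneg fun _ _ => sq_nonneg _) (sq_nonneg _)
      · simp only [mul_pow]
        rw [Finset.sum_product, pow_two Λ, hΛdef, Finset.sum_mul_sum]
      · rw [Finset.sum_product]
        refine (le_of_eq (Finset.sum_congr rfl fun i _ => Finset.sum_congr rfl fun k _ => ?_)).trans
          (sum_levelBound_mul_le hρ hρ6 (Finset.mem_range.1 hj))
        simp only [hg]
        split_ifs
        · rw [← hs2, ← hs2]
          ring
        · simp
    refine (Finset.sum_le_sum this).trans (le_of_eq ?_)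
    rw [← Finset.sum_mul]
    ring
  have hB1 : ∑ i ∈ Finset.range m, ∑ j ∈ Finset.range m, ∑ k ∈ Finset.range m,
      l j ^ 2 * ((l i * l k) * g i j k) ≤ 18 * m * Λ ^ 2 := by
    rw [Finset.sum_comm]; exact hB
  have hB2 : ∑ i ∈ Finset.range m, ∑ j ∈ Finset.range m, ∑ k ∈ Finset.range m,
      l k ^ 2 * ((l i * l j) * g i k j) ≤ 18 * m * Λ ^ 2 := by
    refine le_trans (le_of_eq (Finset.sum_congr rfl fun i _ => ?_)) hB1
    rw [Finset.sum_comm]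
  refine (Finset.sum_le_sum fun i _ => Finset.sum_le_sum fun j _ => Finset.sum_le_sum
    fun k _ => hterm i j k).trans ?_
  simp only [Finset.sum_add_distrib]
  linarith

end LevelSum

section Pairing

variable {ι κ K : Type*} [DecidableEq K]

/-- The sum of `φ a * ψ b` over the pairs `(a, b)` with equal keys `k a = l b`. -/
def pairing (A : Finset ι) (k : ι → K) (φ : ι → ℝ) (B : Finset κ) (l : κ → K) (ψ : κ → ℝ) : ℝ :=
  ∑ a ∈ A, ∑ b ∈ B, if k a = l b then φ a * ψ b else 0

variable {A : Finset ι} {k : ι → K} {φ φ' : ι → ℝ} {B : Finset κ} {l : κ → K} {ψ : κ → ℝ}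

lemma pairing_eq_sum {T : Finset K} (hT : ∀ a ∈ A, k a ∈ T) :
    pairing A k φ B l ψ = ∑ t ∈ T, (∑ a ∈ A, if k a = t then φ a else 0) *
      ∑ b ∈ B, if l b = t then ψ b else 0 := by
  simp only [Finset.sum_mul_sum]
  rw [Finset.sum_comm, pairing]
  refine Finset.sum_congr rfl fun a ha => ?_
  rw [Finset.sum_comm]
  refine Finset.sum_congr rfl fun b _ => ?_
  rw [Finset.sum_eq_single (k a) (fun t _ ht => by rw [if_neg ht.symm, zero_mul])
    (fun h => absurd (hT a ha) h), if_pos rfl]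
  simp only [mul_ite, mul_zero, eq_comm]

lemma pairing_le_sqrt : pairing A k φ B l ψ ≤
    √(pairing A k φ A k φ) * √(pairing B l ψ B l ψ) := by
  have hA : ∀ a ∈ A, k a ∈ A.image k ∪ B.image l := fun a ha =>
    Finset.mem_union_left _ (Finset.mem_image_of_mem k ha)
  have hB : ∀ b ∈ B, l b ∈ A.image k ∪ B.image l := fun b hb =>
    Finset.mem_union_right _ (Finset.mem_image_of_mem l hb)
  rw [pairing_eq_sum hA, pairing_eq_sum hA, pairing_eq_sum hB]
  simp only [← pow_two]
  exact Real.sum_mul_le_sqrt_mul_sqrt _ _ _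

lemma pairing_le_half_add : pairing A k φ A k φ' ≤
    (pairing A k φ A k φ + pairing A k φ' A k φ') / 2 := by
  have hA : ∀ a ∈ A, k a ∈ A.image k := fun a ha => Finset.mem_image_of_mem k ha
  simp only [pairing_eq_sum hA]
  rw [← Finset.sum_add_distrib, Finset.sum_div]
  refine Finset.sum_le_sum fun t _ => ?_
  nlinarith [sq_nonneg ((∑ a ∈ A, if k a = t then φ a else 0) -
    ∑ a ∈ A, if k a = t then φ' a else 0)]

lemma pairing_sum_le {J : Type*} (s : Finset J) (φ : J → ι → ℝ) :
    pairing A k (fun a => ∑ j ∈ s, φ j a) A k (fun a => ∑ j ∈ s, φ j a) ≤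
      s.card * ∑ j ∈ s, pairing A k (φ j) A k (φ j) := by
  have hA : ∀ a ∈ A, k a ∈ A.image k := fun a ha => Finset.mem_image_of_mem k ha
  simp only [pairing_eq_sum hA]
  rw [Finset.sum_comm, Finset.mul_sum]
  refine Finset.sum_le_sum fun t _ => ?_
  have : (∑ a ∈ A, if k a = t then ∑ j ∈ s, φ j a else 0) =
      ∑ j ∈ s, ∑ a ∈ A, if k a = t then φ j a else 0 := by
    rw [Finset.sum_comm]
    refine Finset.sum_congr rfl fun a _ => ?_
    split_ifs <;> simp
  rw [this, ← pow_two]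
  simp only [← pow_two]
  exact sq_sum_le_card_mul_sum_sq

end Pairing

section Rectangles

/-- The standard bilinear form on `ℤ²`. -/
def dot (v w : ℤ × ℤ) : ℤ := v.1 * w.1 + v.2 * w.2

/-- The points `p, q, r, s` are the consecutive vertices of a nondegenerate rectangle. -/
def IsRect (p q r s : ℤ × ℤ) : Prop :=
  p + r = q + s ∧ dot (q - p) (s - p) = 0 ∧ p ≠ q ∧ p ≠ s

instance (p q r s : ℤ × ℤ) : Decidable (IsRect p q r s) := by unfold IsRect; infer_instance

/-- The nondegenerate rectangles with vertices in `S`. -/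
def rects (S : Finset (ℤ × ℤ)) : Finset ((ℤ × ℤ) × (ℤ × ℤ) × (ℤ × ℤ) × (ℤ × ℤ)) :=
  (S ×ˢ S ×ˢ S ×ˢ S).filter fun x => IsRect x.1 x.2.1 x.2.2.1 x.2.2.2

/-- Two directed segments with the same key are opposite sides of a rectangle. -/
def sideKey (a : (ℤ × ℤ) × (ℤ × ℤ)) : (ℤ × ℤ) × ℤ := (a.2 - a.1, dot (a.2 - a.1) a.1)

variable {S : Finset (ℤ × ℤ)}

lemma mem_rects {x : (ℤ × ℤ) × (ℤ × ℤ) × (ℤ × ℤ) × (ℤ × ℤ)} : x ∈ rects S ↔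
    (x.1 ∈ S ∧ x.2.1 ∈ S ∧ x.2.2.1 ∈ S ∧ x.2.2.2 ∈ S) ∧ IsRect x.1 x.2.1 x.2.2.1 x.2.2.2 := by
  simp [rects]

lemma IsRect.shift {p q r s : ℤ × ℤ} (h : IsRect p q r s) : IsRect q r s p := by
  obtain ⟨h1, h2, h3, h4⟩ := h
  obtain rfl : r = q + s - p := by rw [← h1]; abel
  refine ⟨by abel, ?_, fun h => h4 ?_, h3.symm⟩
  · simp only [dot, Prod.fst_sub, Prod.snd_sub, Prod.fst_add, Prod.snd_add] at h2 ⊢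
    linear_combination -h2
  · have : s - p = q + s - p - q := by abel
    rw [← h, sub_self, sub_eq_zero] at this
    exact this.symm

lemma IsRect.flip {p q r s : ℤ × ℤ} (h : IsRect p q r s) : IsRect p s r q := by
  obtain ⟨h1, h2, h3, h4⟩ := h
  refine ⟨by rw [h1, add_comm], ?_, h4, h3⟩
  simp only [dot] at h2 ⊢
  linear_combination h2

lemma sum_rects_shift (G : (ℤ × ℤ) × (ℤ × ℤ) × (ℤ × ℤ) × (ℤ × ℤ) → ℝ) :
    ∑ x ∈ rects S, G x = ∑ x ∈ rects S, G (x.2.1, x.2.2.1, x.2.2.2, x.1) := by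
  symm
  refine Finset.sum_nbij' (fun x => (x.2.1, x.2.2.1, x.2.2.2, x.1))
    (fun x => (x.2.2.2, x.1, x.2.1, x.2.2.1)) ?_ ?_ (fun _ _ => rfl) (fun _ _ => rfl)
    (fun _ _ => rfl)
  · intro x hx
    rw [mem_rects] at hx ⊢
    exact ⟨⟨hx.1.2.1, hx.1.2.2.1, hx.1.2.2.2, hx.1.1⟩, hx.2.shift⟩
  · intro x hx
    rw [mem_rects] at hx ⊢
    exact ⟨⟨hx.1.2.2.2, hx.1.1, hx.1.2.1, hx.1.2.2.1⟩, hx.2.shift.shift.shift⟩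

lemma sum_rects_flip (G : (ℤ × ℤ) × (ℤ × ℤ) × (ℤ × ℤ) × (ℤ × ℤ) → ℝ) :
    ∑ x ∈ rects S, G x = ∑ x ∈ rects S, G (x.1, x.2.2.2, x.2.2.1, x.2.1) := by
  symm
  refine Finset.sum_nbij' (fun x => (x.1, x.2.2.2, x.2.2.1, x.2.1))
    (fun x => (x.1, x.2.2.2, x.2.2.1, x.2.1)) ?_ ?_ (fun _ _ => rfl) (fun _ _ => rfl)
    (fun _ _ => rfl) <;>
  · intro x hx
    rw [mem_rects] at hx ⊢
    exact ⟨⟨hx.1.1, hx.1.2.2.2, hx.1.2.2.1, hx.1.2.1⟩, hx.2.flip⟩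

lemma sideKey_eq_iff {p q r s : ℤ × ℤ} : sideKey (p, q) = sideKey (s, r) ↔
    p + r = q + s ∧ dot (q - p) (s - p) = 0 := by
  simp only [sideKey, Prod.mk.injEq]
  have h1 : q - p = r - s ↔ p + r = q + s := by
    rw [sub_eq_sub_iff_add_eq_add, add_comm r p, eq_comm]
  rw [h1]
  refine and_congr_right fun h => ?_
  rw [← h1.2 h]
  simp only [dot, Prod.fst_sub, Prod.snd_sub]
  constructor <;> intro h' <;> linear_combination -h'

lemma pairing_sideKey_eq (φ ψ : (ℤ × ℤ) × (ℤ × ℤ) → ℝ) :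
    pairing S.offDiag sideKey φ S.offDiag sideKey ψ =
      ∑ x ∈ rects S, φ (x.1, x.2.1) * ψ (x.2.2.2, x.2.2.1) + ∑ a ∈ S.offDiag, φ a * ψ a := by
  have h : ∀ a ∈ S.offDiag, ∀ b ∈ S.offDiag,
      (if sideKey a = sideKey b then φ a * ψ b else 0) =
      (if IsRect a.1 a.2 b.2 b.1 then φ a * ψ b else 0) + if a = b then φ a * ψ b else 0 := by
    rintro ⟨p, q⟩ ha ⟨s, r⟩ hb
    rw [Finset.mem_offDiag] at ha
    simp only [sideKey_eq_iff, IsRect, Prod.mk.injEq]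
    by_cases hps : p = s
    · subst hps
      simp only [ne_eq, not_true_eq_false, and_false, if_false, zero_add, true_and, sub_self]
      refine if_congr ⟨fun h => ?_, fun h => ?_⟩ rfl rfl
      · rw [add_comm] at h
        exact (add_right_cancel h.1).symm
      · subst h
        simp [add_comm, dot]
    · simp [hps, ha.2.2]
  rw [pairing, Finset.sum_congr rfl fun a ha => Finset.sum_congr rfl fun b hb => h a ha b hb]
  simp only [Finset.sum_add_distrib]
  congr 1
  · rw [← Finset.sum_product', ← Finset.sum_filter]
    refine Finset.sum_nbij' (fun c => (c.1.1, c.1.2, c.2.2, c.2.1))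
      (fun x => ((x.1, x.2.1), (x.2.2.2, x.2.2.1))) ?_ ?_ (fun _ _ => rfl) (fun _ _ => rfl)
      (fun _ _ => rfl)
    · intro c hc
      simp only [Finset.mem_filter, Finset.mem_product, Finset.mem_offDiag] at hc
      exact mem_rects.2 ⟨⟨hc.1.1.1, hc.1.1.2.1, hc.1.2.2.1, hc.1.2.1⟩, hc.2⟩
    · intro x hx
      rw [mem_rects] at hx
      simp only [Finset.mem_filter, Finset.mem_product, Finset.mem_offDiag]
      exact ⟨⟨⟨hx.1.1, hx.1.2.1, hx.2.2.2.1⟩, hx.1.2.2.2, hx.1.2.2.1,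
        hx.2.shift.shift.2.2.1.symm⟩, hx.2⟩
  · refine Finset.sum_congr rfl fun a ha => ?_
    rw [Finset.sum_ite_eq, if_pos ha]

variable {f : ℤ × ℤ → ℝ} {R : ℤ × ℤ → ℤ × ℤ → Prop}

lemma sum_offDiag_le (hf : ∀ p, 0 ≤ f p) {φ ψ : (ℤ × ℤ) × (ℤ × ℤ) → ℝ} (hφ0 : ∀ a, 0 ≤ φ a)
    (hφ : ∀ a, φ a ≤ f a.1 * f a.2) (hψ : ∀ a, ψ a ≤ f a.1 * f a.2) :
    ∑ a ∈ S.offDiag, φ a * ψ a ≤ (∑ p ∈ S, f p ^ 2) ^ 2 := by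
  rw [pow_two, Finset.sum_mul_sum, ← Finset.sum_product']
  refine (Finset.sum_le_sum fun a _ => ?_).trans
    (Finset.sum_le_sum_of_subset_of_nonneg (fun a ha => Finset.mem_product.2
      ⟨(Finset.mem_offDiag.1 ha).1, (Finset.mem_offDiag.1 ha).2.1⟩) fun a _ _ => ?_)
  · calc φ a * ψ a ≤ (f a.1 * f a.2) * (f a.1 * f a.2) :=
        mul_le_mul_of_nonneg (hφ a) (hψ a) (hφ0 a) (mul_nonneg (hf _) (hf _))
      _ = f a.1 ^ 2 * f a.2 ^ 2 := by ring
  · positivity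

open Classical in
/-- If a property `R` of a vertex of a rectangle depends only on the directions of its sides, then
the sum over rectangles is controlled by the rectangles on which `R` is constant. -/
theorem pairing_sideKey_le (hf : ∀ p, 0 ≤ f p)
    (hR : ∀ p v w, v ≠ 0 → w ≠ 0 → dot v w = 0 → (R p v ↔ R p w)) :
    pairing S.offDiag sideKey (fun a => f a.1 * f a.2) S.offDiag sideKey
        (fun a => f a.1 * f a.2) ≤
      8 * ∑ x ∈ (rects S).filter (fun x => R x.1 (x.2.1 - x.1) ∧ R x.2.1 (x.2.1 - x.1) ∧
        R x.2.2.1 (x.2.1 - x.1) ∧ R x.2.2.2 (x.2.1 - x.1)),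
        f x.1 * f x.2.1 * f x.2.2.1 * f x.2.2.2 +
      8 * ∑ x ∈ (rects S).filter (fun x => ¬ R x.1 (x.2.1 - x.1) ∧ ¬ R x.2.1 (x.2.1 - x.1) ∧
        ¬ R x.2.2.1 (x.2.1 - x.1) ∧ ¬ R x.2.2.2 (x.2.1 - x.1)),
        f x.1 * f x.2.1 * f x.2.2.1 * f x.2.2.2 +
      24 * (∑ p ∈ S, f p ^ 2) ^ 2 := by
  set h : Bool → ℤ × ℤ → ℤ × ℤ → ℝ := fun b p v => if (R p v ↔ b = true) then f p else 0 with hh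
  set φ : Bool × Bool → (ℤ × ℤ) × (ℤ × ℤ) → ℝ :=
    fun b a => h b.1 a.1 (a.2 - a.1) * h b.2 a.2 (a.2 - a.1) with hφ
  have hh0 : ∀ b p v, 0 ≤ h b p v := fun b p v => by
    simp only [hh]; split_ifs <;> simp [hf]
  have hhf : ∀ b p v, h b p v ≤ f p := fun b p v => by
    simp only [hh]; split_ifs <;> simp [hf]
  have hφ0 : ∀ b a, 0 ≤ φ b a := fun b a => mul_nonneg (hh0 _ _ _) (hh0 _ _ _)
  have hφf : ∀ b a, φ b a ≤ f a.1 * f a.2 := fun b a =>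
    mul_le_mul (hhf _ _ _) (hhf _ _ _) (hh0 _ _ _) (hf _)
  have hsum : (fun a : (ℤ × ℤ) × (ℤ × ℤ) => f a.1 * f a.2) =
      fun a => ∑ b : Bool × Bool, φ b a := by
    funext a
    have : ∀ p v, f p = h true p v + h false p v := fun p v => by
      by_cases hp : R p v <;> simp [hh, hp]
    rw [Fintype.sum_prod_type]
    simp only [Fintype.sum_bool, hφ]
    rw [this a.1 (a.2 - a.1), this a.2 (a.2 - a.1)]
    ring
  have hmix : ∀ b b' : Bool,
      pairing S.offDiag sideKey (φ (b, b')) S.offDiag sideKey (φ (b, b')) ≤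
      (pairing S.offDiag sideKey (φ (b, b)) S.offDiag sideKey (φ (b, b)) +
        pairing S.offDiag sideKey (φ (b', b')) S.offDiag sideKey (φ (b', b'))) / 2 +
        (∑ p ∈ S, f p ^ 2) ^ 2 := by
    intro b b'
    rw [pairing_sideKey_eq]
    refine add_le_add ?_ (sum_offDiag_le hf (hφ0 _) (hφf _) (hφf _))
    refine le_trans ?_ pairing_le_half_add
    rw [pairing_sideKey_eq, sum_rects_flip]
    refine le_trans (le_of_eq (Finset.sum_congr rfl fun x hx => ?_))
      (le_add_of_nonneg_right (Finset.sum_nonneg fun a _ => mul_nonneg (hφ0 _ _) (hφ0 _ _)))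
    obtain ⟨-, h1, h2, h3, h4⟩ := mem_rects.1 hx
    have h5 : x.2.2.1 - x.2.1 = x.2.2.2 - x.1 := by
      rw [sub_eq_sub_iff_add_eq_add, add_comm, h1, add_comm]
    have h6 : x.2.2.1 - x.2.2.2 = x.2.1 - x.1 := by
      rw [sub_eq_sub_iff_add_eq_add, add_comm, h1]
    have h7 : ∀ b p, h b p (x.2.2.2 - x.1) = h b p (x.2.1 - x.1) := fun b p => by
      simp only [hh]
      rw [hR p _ _ (sub_ne_zero.2 h3.symm) (sub_ne_zero.2 h4.symm) h2]
    simp only [hφ, h5, h6, h7]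
    ring
  have hpure : ∀ b : Bool, pairing S.offDiag sideKey (φ (b, b)) S.offDiag sideKey (φ (b, b)) ≤
      ∑ x ∈ (rects S).filter (fun x => (R x.1 (x.2.1 - x.1) ↔ b = true) ∧
        (R x.2.1 (x.2.1 - x.1) ↔ b = true) ∧
        (R x.2.2.1 (x.2.1 - x.1) ↔ b = true) ∧ (R x.2.2.2 (x.2.1 - x.1) ↔ b = true)),
        f x.1 * f x.2.1 * f x.2.2.1 * f x.2.2.2 + (∑ p ∈ S, f p ^ 2) ^ 2 := by
    intro b
    rw [pairing_sideKey_eq]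
    refine add_le_add (le_of_eq ?_) (sum_offDiag_le hf (hφ0 _) (hφf _) (hφf _))
    rw [Finset.sum_filter]
    refine Finset.sum_congr rfl fun x hx => ?_
    obtain ⟨-, h1, h2, h3, h4⟩ := mem_rects.1 hx
    have h6 : x.2.2.1 - x.2.2.2 = x.2.1 - x.1 := by
      rw [sub_eq_sub_iff_add_eq_add, add_comm, h1]
    simp only [hφ, h6, hh]
    by_cases e1 : (R x.1 (x.2.1 - x.1) ↔ b = true) <;>
    by_cases e2 : (R x.2.1 (x.2.1 - x.1) ↔ b = true) <;>
    by_cases e3 : (R x.2.2.1 (x.2.1 - x.1) ↔ b = true) <;>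
    by_cases e4 : (R x.2.2.2 (x.2.1 - x.1) ↔ b = true) <;>
    simp only [e1, e2, e3, e4, and_self, and_true, and_false, if_true, if_false,
      mul_zero, zero_mul]
    ring
  rw [hsum]
  refine (pairing_sum_le _ _).trans ?_
  rw [Fintype.sum_prod_type]
  simp only [Fintype.sum_bool, Finset.card_univ, Fintype.card_prod, Fintype.card_bool]
  have e1 := hpure true
  have e2 := hpure false
  simp only [iff_true, Bool.false_eq_true, iff_false] at e1 e2
  have e3 := hmix true false
  have e4 := hmix false true
  push_cast
  linarith

end Rectangles

section Geometry

/-- The rotation of `v` by a right angle. -/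
def perp (v : ℤ × ℤ) : ℤ × ℤ := (-v.2, v.1)

/-- The number of points of `B` on the line through `p` with direction `v`. -/
def lineCount (B : Finset (ℤ × ℤ)) (p v : ℤ × ℤ) : ℕ :=
  (B.filter fun r => dot (perp v) (r - p) = 0).card

/-- An abscissa separating the points of a finite set for generic `K`. -/
def shear (K : ℚ) (p : ℤ × ℤ) : ℚ := p.1 + K * p.2

/-- The direction of a nonzero vector. -/
def direction (v : ℤ × ℤ) : Bool × ℚ := (decide (v.1 = 0), v.2 / v.1)

lemma eq_zero_of_dot_self {v : ℤ × ℤ} (h : dot v v = 0) : v = 0 := by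
  simp only [dot] at h
  have h1 : v.1 = 0 := by nlinarith [mul_self_nonneg v.1, mul_self_nonneg v.2]
  have h2 : v.2 = 0 := by nlinarith [mul_self_nonneg v.1, mul_self_nonneg v.2]
  exact Prod.ext h1 h2

lemma exists_shear_injOn (S : Finset (ℤ × ℤ)) : ∃ K : ℚ, Set.InjOn (shear K) S := by
  classical
  obtain ⟨K, hK⟩ := Infinite.exists_notMem_finset ((S ×ˢ S).image
    fun c => ((c.1.1 - c.2.1 : ℚ) / (c.2.2 - c.1.2)))
  refine ⟨K, fun p hp q hq h => ?_⟩
  simp only [shear] at h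
  by_cases h2 : p.2 = q.2
  · rw [h2] at h
    exact Prod.ext (by exact_mod_cast add_right_cancel h) h2
  · refine absurd (Finset.mem_image.2 ⟨(p, q), Finset.mem_product.2 ⟨hp, hq⟩, ?_⟩) hK
    have : (q.2 - p.2 : ℚ) ≠ 0 := sub_ne_zero.2 (by exact_mod_cast Ne.symm h2)
    rw [div_eq_iff this]
    linear_combination h

lemma onLine_lineOf_iff {K : ℚ} {p q r : ℤ × ℤ} (h : shear K p ≠ shear K q) :
    OnLine (shear K) (fun p => (p.2 : ℚ)) r (lineOf (shear K) (fun p => (p.2 : ℚ)) (p, q)) ↔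
      dot (perp (q - p)) (r - p) = 0 := by
  have h0 : shear K q - shear K p ≠ 0 := sub_ne_zero.2 h.symm
  have h1 : OnLine (shear K) (fun p => (p.2 : ℚ)) r
      (lineOf (shear K) (fun p => (p.2 : ℚ)) (p, q)) ↔
      (r.2 - p.2 : ℚ) * (shear K q - shear K p) = (q.2 - p.2) * (shear K r - shear K p) := by
    rw [OnLine, ← ordinate_eq, ordinate, slope, ← sub_eq_iff_eq_add', div_mul_eq_mul_div,
      eq_div_iff h0]
  rw [h1, ← Int.cast_inj (α := ℚ)]
  simp only [shear, dot, perp, Prod.fst_sub, Prod.snd_sub]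
  push_cast
  constructor <;> intro h <;> linear_combination h

lemma direction_eq_iff {v w : ℤ × ℤ} (hv : v ≠ 0) (hw : w ≠ 0) :
    direction v = direction w ↔ dot (perp v) w = 0 := by
  obtain ⟨a, b⟩ := v
  obtain ⟨c, d⟩ := w
  simp only [direction, dot, perp, Prod.mk.injEq, decide_eq_decide, ne_eq, Prod.mk_eq_zero] at *
  by_cases ha : a = 0 <;> by_cases hc : c = 0
  · simp [ha, hc]
  · have hb : b ≠ 0 := fun h => hv ⟨ha, h⟩
    simp [ha, hb, hc]
  · have hd : d ≠ 0 := fun h => hw ⟨hc, h⟩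
    simp [ha, hd, hc]
  · have ha' : (a : ℚ) ≠ 0 := by exact_mod_cast ha
    have hc' : (c : ℚ) ≠ 0 := by exact_mod_cast hc
    simp only [ha, hc, true_and]
    rw [div_eq_div_iff ha' hc']
    norm_cast
    constructor <;> intro h <;> linear_combination -h

lemma perp_ne_zero {v : ℤ × ℤ} (hv : v ≠ 0) : perp v ≠ 0 := by
  intro h
  simp only [perp, Prod.mk_eq_zero, neg_eq_zero] at h
  exact hv (Prod.ext h.2 h.1)

lemma dot_perp_perp (v w : ℤ × ℤ) : dot (perp v) (perp w) = dot v w := by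
  simp only [dot, perp]; ring

lemma lineCount_congr {v w : ℤ × ℤ} (hv : v ≠ 0) (hw : w ≠ 0) (h : dot (perp v) w = 0)
    (B : Finset (ℤ × ℤ)) (p : ℤ × ℤ) : lineCount B p v = lineCount B p w := by
  unfold lineCount
  congr 1
  refine Finset.filter_congr fun r _ => ?_
  by_cases hr : r - p = 0
  · simp [hr, dot]
  · rw [← direction_eq_iff hv hr, ← direction_eq_iff hw hr, (direction_eq_iff hv hw).2 h]

lemma lineCount_translate {p q v : ℤ × ℤ} (h : dot (perp v) (q - p) = 0) (B : Finset (ℤ × ℤ)) :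
    lineCount B p v = lineCount B q v := by
  unfold lineCount
  congr 1
  refine Finset.filter_congr fun r _ => ?_
  simp only [dot, Prod.fst_sub, Prod.snd_sub] at h ⊢
  constructor <;> intro h'
  · linear_combination h' - h
  · linear_combination h' + h

end Geometry

section Rich

variable {S : Finset (ℤ × ℤ)} {lv : ℤ × ℤ → ℕ}

/-- The points of `S` of level `j`. -/
def levelSet (S : Finset (ℤ × ℤ)) (lv : ℤ × ℤ → ℕ) (j : ℕ) : Finset (ℤ × ℤ) :=
  S.filter fun p => lv p = j

/-- One of the lines through `p` parallel or orthogonal to `v` contains many points of the level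
of `p`. -/
def IsRich (S : Finset (ℤ × ℤ)) (lv : ℤ × ℤ → ℕ) (p v : ℤ × ℤ) : Prop :=
  2 ^ lv p < lineCount (levelSet S lv (lv p)) p v ^ 2 ∨
    2 ^ lv p < lineCount (levelSet S lv (lv p)) p (perp v) ^ 2

lemma lineCount_of_dot {v w : ℤ × ℤ} (hv : v ≠ 0) (hw : w ≠ 0) (h : dot v w = 0)
    (B : Finset (ℤ × ℤ)) (p : ℤ × ℤ) : lineCount B p (perp v) = lineCount B p w := by
  refine lineCount_congr (perp_ne_zero hv) hw ?_ B p
  simp only [dot, perp] at h ⊢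
  linear_combination -h

lemma dot_comm (v w : ℤ × ℤ) : dot v w = dot w v := by simp only [dot]; ring

lemma isRich_congr (p v w : ℤ × ℤ) (hv : v ≠ 0) (hw : w ≠ 0) (h : dot v w = 0) :
    IsRich S lv p v ↔ IsRich S lv p w := by
  unfold IsRich
  rw [lineCount_of_dot hv hw h, lineCount_of_dot hw hv (dot_comm v w ▸ h), or_comm]

lemma IsRect.ne_zero {p q r s : ℤ × ℤ} (h : IsRect p q r s) : q - p ≠ 0 :=
  sub_ne_zero.2 h.2.2.1.symm

lemma IsRect.dot_eq {p q r s : ℤ × ℤ} (h : IsRect p q r s) : dot (q - p) (r - q) = 0 := by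
  have : r - q = s - p := by rw [sub_eq_sub_iff_add_eq_add, add_comm, h.1, add_comm]
  rw [this, h.2.1]

lemma IsRect.eq_of_collinear {p q q' r s s' : ℤ × ℤ} (h : IsRect p q r s)
    (h' : IsRect p q' r s') (hl : dot (perp (q - p)) (q' - p) = 0) : q = q' := by
  have hv := h.ne_zero
  have hv' := h'.ne_zero
  have h1 := h.dot_eq
  have h2 := h'.dot_eq
  rw [show r - q = (r - p) - (q - p) by abel] at h1
  rw [show r - q' = (r - p) - (q' - p) by abel] at h2
  rw [← sub_left_inj (a := p)]
  generalize q - p = v at *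
  generalize q' - p = w at *
  generalize r - p = u at *
  simp only [dot, perp, Prod.fst_sub, Prod.snd_sub] at h1 h2 hl
  have key : ∀ {v w : ℤ × ℤ}, v ≠ 0 → v.1 * (u.1 - v.1) + v.2 * (u.2 - v.2) = 0 →
      w.1 * (u.1 - w.1) + w.2 * (u.2 - w.2) = 0 → -v.2 * w.1 + v.1 * w.2 = 0 →
      v.1 * w.1 + v.2 * w.2 = w.1 * w.1 + w.2 * w.2 := by
    intro v w hv h1 h2 hl
    have e1 : v.1 * (v.1 * w.1 + v.2 * w.2 - (w.1 * w.1 + w.2 * w.2)) = 0 := by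
      linear_combination (-w.1) * h1 + v.1 * h2 + (v.2 - u.2) * hl
    have e2 : v.2 * (v.1 * w.1 + v.2 * w.2 - (w.1 * w.1 + w.2 * w.2)) = 0 := by
      linear_combination (-w.2) * h1 + v.2 * h2 + (u.1 - v.1) * hl
    rcases mul_eq_zero.1 e1 with h | h
    · rcases mul_eq_zero.1 e2 with h' | h'
      · exact absurd (Prod.ext h h') hv
      · linarith
    · linarith
  have k1 := key hv h1 h2 hl
  have k2 := key hv' h2 h1 (by linear_combination -hl)
  rw [← sub_eq_zero]
  apply eq_zero_of_dot_self
  simp only [dot, Prod.fst_sub, Prod.snd_sub]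
  linear_combination -k1 - k2

end Rich

lemma sum_le_sum_of_injOn {ι κ : Type*} {s : Finset ι} {t : Finset κ} {g : ι → ℝ} {h : κ → ℝ}
    (i : ι → κ) (hi : ∀ x ∈ s, i x ∈ t) (hinj : Set.InjOn i s) (hgh : ∀ x ∈ s, g x ≤ h (i x))
    (hh : ∀ y ∈ t, 0 ≤ h y) : ∑ x ∈ s, g x ≤ ∑ y ∈ t, h y := by
  classical
  refine (Finset.sum_le_sum hgh).trans ?_
  rw [← Finset.sum_image (f := h) hinj]
  exact Finset.sum_le_sum_of_subset_of_nonneg (Finset.image_subset_iff.2 hi)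
    fun y hy _ => hh y hy

section RichRectangles

variable {S : Finset (ℤ × ℤ)} {lv : ℤ × ℤ → ℕ} {K : ℚ} {m : ℕ} {F : ℕ → ℝ} {f : ℤ × ℤ → ℝ}

lemma mem_levelSet {p : ℤ × ℤ} {j : ℕ} : p ∈ levelSet S lv j ↔ p ∈ S ∧ lv p = j :=
  Finset.mem_filter

lemma lineCount_eq_card_ptsOn {p q : ℤ × ℤ} (h : shear K p ≠ shear K q) (B : Finset (ℤ × ℤ)) :
    lineCount B p (q - p) = (ptsOn (shear K) (fun p => (p.2 : ℚ)) B
      (lineOf (shear K) (fun p => (p.2 : ℚ)) (p, q))).card := by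
  classical
  unfold lineCount ptsOn
  congr 1
  exact Finset.filter_congr fun r _ => (onLine_lineOf_iff h).symm

/-- The lines containing many points of level `j`. -/
noncomputable def levelLines (S : Finset (ℤ × ℤ)) (lv : ℤ × ℤ → ℕ) (K : ℚ) (j : ℕ) :
    Finset (ℚ × ℚ) :=
  richLines (shear K) (fun p => (p.2 : ℚ)) (levelSet S lv j) (Nat.sqrt (2 ^ j) + 1)

lemma two_le_sqrt_succ (j : ℕ) : 2 ≤ Nat.sqrt (2 ^ j) + 1 := by
  have : 0 < Nat.sqrt (2 ^ j) := Nat.sqrt_pos.2 (by positivity)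
  omega

lemma shear_injOn_levelSet (hK : Set.InjOn (shear K) S) (j : ℕ) :
    Set.InjOn (shear K) (levelSet S lv j) :=
  hK.mono (Finset.coe_subset.2 (Finset.filter_subset _ _))

lemma lineOf_mem_levelLines (hK : Set.InjOn (shear K) S) {p q : ℤ × ℤ}
    (h : shear K p ≠ shear K q) {j : ℕ} (hr : 2 ^ j < lineCount (levelSet S lv j) p (q - p) ^ 2) :
    lineOf (shear K) (fun p => (p.2 : ℚ)) (p, q) ∈ levelLines S lv K j := by
  rw [levelLines, mem_richLines (shear_injOn_levelSet hK j) (two_le_sqrt_succ j),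
    ← lineCount_eq_card_ptsOn h, Nat.succ_le_iff, Nat.sqrt_lt']
  exact hr

open Classical in
lemma sum_levelLines_le (hK : Set.InjOn (shear K) S) (hlm : ∀ p ∈ S, lv p < m)
    (hlv : ∀ j, (levelSet S lv j).card ≤ 2 ^ j) (hf : ∀ p, 0 ≤ f p)
    (hfF : ∀ p ∈ S, f p ≤ F (lv p)) :
    ∑ p ∈ S, f p ^ 2 * (((levelLines S lv K (lv p)).filter
      fun l => OnLine (shear K) (fun p => (p.2 : ℚ)) p l).card : ℝ) ≤
      11000 * ∑ j ∈ Finset.range m, 2 ^ j * F j ^ 2 := by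
  rw [← Finset.sum_fiberwise_of_maps_to (g := lv) (t := Finset.range m)
    fun p hp => Finset.mem_range.2 (hlm p hp), Finset.mul_sum]
  refine Finset.sum_le_sum fun j _ => ?_
  calc _ ≤ ∑ p ∈ levelSet S lv j, F j ^ 2 * (((levelLines S lv K j).filter
      fun l => OnLine (shear K) (fun p => (p.2 : ℚ)) p l).card : ℝ) := by
        refine Finset.sum_le_sum fun p hp => ?_
        obtain ⟨hpS, rfl⟩ := mem_levelSet.1 hp
        gcongr
        · exact hf p
        · exact hfF p hpS
    _ = F j ^ 2 * ∑ l ∈ levelLines S lv K j, ((ptsOn (shear K) (fun p => (p.2 : ℚ))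
          (levelSet S lv j) l).card : ℝ) := by
        rw [← Finset.mul_sum]
        congr 1
        simp only [ptsOn, Finset.card_filter, Nat.cast_sum]
        exact Finset.sum_comm
    _ ≤ F j ^ 2 * (11000 * 2 ^ j) := by
        gcongr
        refine sum_ptsOn_richLines_le (shear_injOn_levelSet hK j) (one_le_pow₀ one_le_two)
          (by exact_mod_cast hlv j) (two_le_sqrt_succ j) ?_
        exact_mod_cast (Nat.lt_succ_sqrt' (2 ^ j)).le
    _ = 11000 * (2 ^ j * F j ^ 2) := by ring

open Classical in
lemma sum_rects_richSide_le (hK : Set.InjOn (shear K) S) (hlm : ∀ p ∈ S, lv p < m)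
    (hlv : ∀ j, (levelSet S lv j).card ≤ 2 ^ j) (hf : ∀ p, 0 ≤ f p)
    (hfF : ∀ p ∈ S, f p ≤ F (lv p)) :
    ∑ x ∈ rects S, (if 2 ^ lv x.1 < lineCount (levelSet S lv (lv x.1)) x.1 (x.2.1 - x.1) ^ 2 then
      f x.1 ^ 2 * f x.2.2.1 ^ 2 else 0) ≤
      11000 * (∑ j ∈ Finset.range m, 2 ^ j * F j ^ 2) * ∑ p ∈ S, f p ^ 2 := by
  set T : Finset (Σ _ : (ℤ × ℤ) × (ℤ × ℤ), ℚ × ℚ) := (S ×ˢ S).sigma fun c =>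
    (levelLines S lv K (lv c.1)).filter fun l => OnLine (shear K) (fun p => (p.2 : ℚ)) c.1 l
  have hsep : ∀ x ∈ rects S, shear K x.1 ≠ shear K x.2.1 := fun x hx h =>
    (mem_rects.1 hx).2.2.2.1 (hK (mem_rects.1 hx).1.1 (mem_rects.1 hx).1.2.1 h)
  rw [← Finset.sum_filter]
  calc _ ≤ ∑ y ∈ T, f y.1.1 ^ 2 * f y.1.2 ^ 2 := by
        refine sum_le_sum_of_injOn
          (fun x => ⟨(x.1, x.2.2.1), lineOf (shear K) (fun p => (p.2 : ℚ)) (x.1, x.2.1)⟩)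
          ?_ ?_ (fun _ _ => le_rfl) (fun _ _ => by positivity)
        · intro x hx
          rw [Finset.mem_filter] at hx
          obtain ⟨hx, hr⟩ := hx
          have h := mem_rects.1 hx
          refine Finset.mem_sigma.2 ⟨Finset.mem_product.2 ⟨h.1.1, h.1.2.2.1⟩,
            Finset.mem_filter.2 ⟨lineOf_mem_levelLines hK (hsep x hx) hr,
              onLine_fst (x.1, x.2.1)⟩⟩
        · rintro ⟨p, q, r, s⟩ hx ⟨p', q', r', s'⟩ hx' h
          simp only [Sigma.mk.injEq, Prod.mk.injEq, heq_eq_eq] at h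
          obtain ⟨⟨rfl, rfl⟩, h⟩ := h
          have hx := Finset.mem_of_mem_filter _ hx
          have hx' := Finset.mem_of_mem_filter _ hx'
          have hq : q = q' := by
            refine (mem_rects.1 hx).2.eq_of_collinear (mem_rects.1 hx').2 ?_
            rw [← onLine_lineOf_iff (hsep _ hx), h]
            exact onLine_snd (e := (p, q')) (hsep _ hx')
          subst hq
          have h1 := (mem_rects.1 hx).2.1
          have h2 := (mem_rects.1 hx').2.1
          have : s = s' := add_left_cancel (h1.symm.trans h2)
          rw [this]
    _ = (∑ p ∈ S, f p ^ 2 * (((levelLines S lv K (lv p)).filter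
          fun l => OnLine (shear K) (fun p => (p.2 : ℚ)) p l).card : ℝ)) * ∑ r ∈ S, f r ^ 2 := by
        rw [Finset.sum_sigma, Finset.sum_mul_sum, Finset.sum_product]
        refine Finset.sum_congr rfl fun p _ => Finset.sum_congr rfl fun r _ => ?_
        dsimp only
        rw [Finset.sum_const, nsmul_eq_mul]
        ring
    _ ≤ _ := by
        refine mul_le_mul_of_nonneg_right (sum_levelLines_le hK hlm hlv hf hfF) ?_
        exact Finset.sum_nonneg fun _ _ => sq_nonneg _

open Classical in
/-- The contribution of the rectangles all of whose vertices are rich. -/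
theorem sum_rects_rich_le (hlm : ∀ p ∈ S, lv p < m)
    (hlv : ∀ j, (levelSet S lv j).card ≤ 2 ^ j) (hf : ∀ p, 0 ≤ f p)
    (hfF : ∀ p ∈ S, f p ≤ F (lv p)) :
    ∑ x ∈ (rects S).filter (fun x => IsRich S lv x.1 (x.2.1 - x.1) ∧
        IsRich S lv x.2.1 (x.2.1 - x.1) ∧ IsRich S lv x.2.2.1 (x.2.1 - x.1) ∧
        IsRich S lv x.2.2.2 (x.2.1 - x.1)), f x.1 * f x.2.1 * f x.2.2.1 * f x.2.2.2 ≤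
      22000 * (∑ j ∈ Finset.range m, 2 ^ j * F j ^ 2) * ∑ p ∈ S, f p ^ 2 := by
  obtain ⟨K, hK⟩ := exists_shear_injOn S
  set N : (ℤ × ℤ) × (ℤ × ℤ) × (ℤ × ℤ) × (ℤ × ℤ) → ℝ := fun x =>
    if 2 ^ lv x.1 < lineCount (levelSet S lv (lv x.1)) x.1 (x.2.1 - x.1) ^ 2 then
      f x.1 ^ 2 * f x.2.2.1 ^ 2 else 0 with hN
  set G : (ℤ × ℤ) × (ℤ × ℤ) × (ℤ × ℤ) × (ℤ × ℤ) → ℝ := fun x =>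
    if IsRich S lv x.1 (x.2.1 - x.1) then f x.1 ^ 2 * f x.2.2.1 ^ 2 else 0 with hG
  have hN0 : ∀ x, 0 ≤ N x := fun x => by simp only [hN]; split_ifs <;> positivity
  have hG0 : ∀ x, 0 ≤ G x := fun x => by simp only [hG]; split_ifs <;> positivity
  have hGN : ∑ x ∈ rects S, G x ≤ 2 * ∑ x ∈ rects S, N x := by
    rw [two_mul]
    nth_rw 2 [sum_rects_flip]
    rw [← Finset.sum_add_distrib]
    refine Finset.sum_le_sum fun x hx => ?_
    have h := (mem_rects.1 hx).2
    have h1 := lineCount_of_dot h.ne_zero h.flip.ne_zero h.2.1 (levelSet S lv (lv x.1)) x.1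
    by_cases hr : IsRich S lv x.1 (x.2.1 - x.1)
    · rcases hr with hr' | hr'
      · have : N x = G x := by simp only [hN, hG, if_pos hr', IsRich, hr', true_or, if_true]
        rw [← this]
        exact le_add_of_nonneg_left (hN0 _)
      · have : N (x.1, x.2.2.2, x.2.2.1, x.2.1) = G x := by
          have hr'' := hr'
          rw [h1] at hr''
          simp only [hN, hG, if_pos hr'', IsRich, hr', or_true, if_true]
        rw [← this]
        exact le_add_of_nonneg_right (hN0 _)
    · have : G x = 0 := if_neg hr
      rw [this]
      exact add_nonneg (hN0 _) (hN0 _)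
  have hle : 2 * ∑ x ∈ (rects S).filter (fun x => IsRich S lv x.1 (x.2.1 - x.1) ∧
        IsRich S lv x.2.1 (x.2.1 - x.1) ∧ IsRich S lv x.2.2.1 (x.2.1 - x.1) ∧
        IsRich S lv x.2.2.2 (x.2.1 - x.1)), f x.1 * f x.2.1 * f x.2.2.1 * f x.2.2.2 ≤
      2 * ∑ x ∈ rects S, G x := by
    rw [two_mul (∑ x ∈ rects S, G x)]
    nth_rw 2 [sum_rects_shift]
    rw [← Finset.sum_add_distrib, Finset.mul_sum, Finset.sum_filter]
    refine Finset.sum_le_sum fun x hx => ?_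
    have h := (mem_rects.1 hx).2
    split_ifs with hr
    · have h1 : G x = f x.1 ^ 2 * f x.2.2.1 ^ 2 := if_pos hr.1
      have h2 : G (x.2.1, x.2.2.1, x.2.2.2, x.1) = f x.2.1 ^ 2 * f x.2.2.2 ^ 2 :=
        if_pos ((isRich_congr x.2.1 _ _ h.ne_zero h.shift.ne_zero h.dot_eq).1 hr.2.1)
      rw [h1, h2]
      nlinarith [sq_nonneg (f x.1 * f x.2.2.1 - f x.2.1 * f x.2.2.2)]
    · exact add_nonneg (hG0 _) (hG0 _)
  have := sum_rects_richSide_le hK hlm hlv hf hfF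
  linarith

end RichRectangles

section PoorRectangles

variable {S : Finset (ℤ × ℤ)} {lv : ℤ × ℤ → ℕ} {m : ℕ} {F : ℕ → ℝ} {f : ℤ × ℤ → ℝ} {ρ : ℝ}

/-- The pairs of points of levels `i` and `j` spanning a line with few points of level `j`. -/
def poorPairs (S : Finset (ℤ × ℤ)) (lv : ℤ × ℤ → ℕ) (i j : ℕ) : Finset ((ℤ × ℤ) × (ℤ × ℤ)) :=
  S.offDiag.filter fun e => lv e.1 = i ∧ lv e.2 = j ∧
    lineCount (levelSet S lv j) e.1 (e.2 - e.1) ^ 2 ≤ 2 ^ j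

/-- The first point of `e` together with the direction of `e`. -/
def rayKey (e : (ℤ × ℤ) × (ℤ × ℤ)) : (ℤ × ℤ) × (Bool × ℚ) := (e.1, direction (e.2 - e.1))

/-- The first point of `e` together with the direction orthogonal to `e`. -/
def normalKey (e : (ℤ × ℤ) × (ℤ × ℤ)) : (ℤ × ℤ) × (Bool × ℚ) :=
  (e.1, direction (perp (e.2 - e.1)))

lemma mem_poorPairs {i j : ℕ} {e : (ℤ × ℤ) × (ℤ × ℤ)} : e ∈ poorPairs S lv i j ↔
    (e.1 ∈ S ∧ e.2 ∈ S ∧ e.1 ≠ e.2) ∧ lv e.1 = i ∧ lv e.2 = j ∧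
      lineCount (levelSet S lv j) e.1 (e.2 - e.1) ^ 2 ≤ 2 ^ j := by
  rw [poorPairs, Finset.mem_filter, Finset.mem_offDiag]

lemma sum_lineCount_poorPairs_le (hρ : 0 < ρ) (hρ6 : ρ ^ 6 = 2)
    (hlv : ∀ j, (levelSet S lv j).card ≤ 2 ^ j) (i : ℕ) {j : ℕ} (hj : j < m) :
    ∑ e ∈ poorPairs S lv i j, (lineCount (levelSet S lv j) e.1 (e.2 - e.1) : ℝ) ≤
      200000 * (2 ^ (i + j) * levelBound ρ m i j) := by
  obtain ⟨K, hK⟩ := exists_shear_injOn S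
  have hsep : ∀ e ∈ poorPairs S lv i j, shear K e.1 ≠ shear K e.2 := fun e he h =>
    (mem_poorPairs.1 he).1.2.2 (hK (mem_poorPairs.1 he).1.1 (mem_poorPairs.1 he).1.2.1 h)
  rw [Finset.sum_congr rfl fun e he => by rw [lineCount_eq_card_ptsOn (hsep e he)]]
  have hab : (2 : ℝ) ^ j = 2 ^ i * (ρ ^ j / ρ ^ i) ^ 6 := by
    have : ∀ n, (ρ ^ n) ^ 6 = 2 ^ n := fun n => by rw [← hρ6]; ring
    rw [div_pow, this, this]
    field_simp
  have hM : (2 : ℝ) ^ j < 4 ^ m := calc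
    (2 : ℝ) ^ j < 2 ^ m := pow_lt_pow_right₀ one_lt_two hj
    _ ≤ 4 ^ m := by gcongr; norm_num
  refine (sum_ptsOn_poor_le (shear_injOn_levelSet (lv := lv) hK i)
    (shear_injOn_levelSet (lv := lv) hK j) (by positivity : (0 : ℝ) < 2 ^ i)
    (by positivity : 0 < ρ ^ j / ρ ^ i) (by exact_mod_cast hlv i) (by exact_mod_cast hlv j)
    hab hM fun e he => ?_).trans (le_of_eq ?_)
  · have h := mem_poorPairs.1 he
    refine ⟨mem_levelSet.2 ⟨h.1.1, h.2.1⟩, mem_levelSet.2 ⟨h.1.2.1, h.2.2.1⟩, hsep e he, ?_⟩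
    rw [← lineCount_eq_card_ptsOn (hsep e he)]
    exact_mod_cast h.2.2.2
  · rw [levelBound, pow_add]
    ring

lemma pairing_rayKey_le (hρ : 0 < ρ) (hρ6 : ρ ^ 6 = 2)
    (hlv : ∀ j, (levelSet S lv j).card ≤ 2 ^ j) (i : ℕ) {j : ℕ} (hj : j < m) :
    pairing (poorPairs S lv i j) rayKey (fun _ => 1) (poorPairs S lv i j) rayKey (fun _ => 1) ≤
      200000 * (2 ^ (i + j) * levelBound ρ m i j) := by
  refine le_trans (Finset.sum_le_sum fun e he => ?_) (sum_lineCount_poorPairs_le hρ hρ6 hlv i hj)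
  simp only [mul_one]
  rw [← Finset.sum_filter, Finset.sum_const, nsmul_eq_mul, mul_one, Nat.cast_le, lineCount]
  have h := mem_poorPairs.1 he
  refine Finset.card_le_card_of_injOn Prod.snd (fun e' he' => ?_) fun e' he' e'' he'' h => ?_
  · obtain ⟨he', hk⟩ := Finset.mem_filter.1 he'
    have h' := mem_poorPairs.1 he'
    obtain ⟨hk1, hk2⟩ := Prod.ext_iff.1 hk
    dsimp only [rayKey] at hk1 hk2
    refine Finset.mem_filter.2 ⟨mem_levelSet.2 ⟨h'.1.2.1, h'.2.2.1⟩, ?_⟩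
    rw [← hk1] at hk2
    refine (direction_eq_iff (sub_ne_zero.2 h.1.2.2.symm) (sub_ne_zero.2 ?_)).1 hk2
    rw [hk1]
    exact h'.1.2.2.symm
  · have h1 : e.1 = e'.1 := (Prod.ext_iff.1 (Finset.mem_filter.1 he').2).1
    have h2 : e.1 = e''.1 := (Prod.ext_iff.1 (Finset.mem_filter.1 he'').2).1
    exact Prod.ext (h1.symm.trans h2) h

lemma pairing_normalKey_eq (i j : ℕ) :
    pairing (poorPairs S lv i j) normalKey (fun _ => 1) (poorPairs S lv i j) normalKey
        (fun _ => 1) =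
      pairing (poorPairs S lv i j) rayKey (fun _ => 1) (poorPairs S lv i j) rayKey
        (fun _ => 1) := by
  refine Finset.sum_congr rfl fun e he => Finset.sum_congr rfl fun e' he' => if_congr ?_ rfl rfl
  have h := sub_ne_zero.2 (mem_poorPairs.1 he).1.2.2.symm
  have h' := sub_ne_zero.2 (mem_poorPairs.1 he').1.2.2.symm
  simp only [normalKey, rayKey, Prod.mk.injEq]
  rw [direction_eq_iff (perp_ne_zero h) (perp_ne_zero h'), direction_eq_iff h h', dot_perp_perp]

/-- All the vertices of the rectangle `x` are poor. -/
def IsPoorRect (S : Finset (ℤ × ℤ)) (lv : ℤ × ℤ → ℕ)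
    (x : (ℤ × ℤ) × (ℤ × ℤ) × (ℤ × ℤ) × (ℤ × ℤ)) : Prop :=
  ¬ IsRich S lv x.1 (x.2.1 - x.1) ∧ ¬ IsRich S lv x.2.1 (x.2.1 - x.1) ∧
    ¬ IsRich S lv x.2.2.1 (x.2.1 - x.1) ∧ ¬ IsRich S lv x.2.2.2 (x.2.1 - x.1)

lemma isPoorRect_shift {p q r s : ℤ × ℤ} (h : IsRect p q r s) :
    IsPoorRect S lv (q, r, s, p) ↔ IsPoorRect S lv (p, q, r, s) := by
  have key : ∀ t, IsRich S lv t (r - q) ↔ IsRich S lv t (q - p) := fun t =>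
    (isRich_congr t _ _ h.ne_zero h.shift.ne_zero h.dot_eq).symm
  simp only [IsPoorRect, key]
  tauto

open Classical in
lemma card_poorRect_le (hρ : 0 < ρ) (hρ6 : ρ ^ 6 = 2)
    (hlv : ∀ j, (levelSet S lv j).card ≤ 2 ^ j) (i : ℕ) {j k : ℕ} (hj : j < m) (hk : k < m) :
    ((((rects S).filter (IsPoorRect S lv)).filter
      fun x => (lv x.1, lv x.2.1, lv x.2.2.2) = (i, j, k)).card : ℝ) ≤
      200000 * (√(2 ^ (i + j) * levelBound ρ m i j) * √(2 ^ (i + k) * levelBound ρ m i k)) := by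
  calc _ = ∑ x ∈ ((rects S).filter (IsPoorRect S lv)).filter
          fun x => (lv x.1, lv x.2.1, lv x.2.2.2) = (i, j, k), (1 : ℝ) := by simp
    _ ≤ pairing (poorPairs S lv i j) rayKey (fun _ => 1) (poorPairs S lv i k) normalKey
          (fun _ => 1) := by
        rw [pairing, ← Finset.sum_product']
        refine sum_le_sum_of_injOn (fun x => ((x.1, x.2.1), (x.1, x.2.2.2))) ?_ ?_ ?_
          (fun _ _ => by split_ifs <;> simp)
        · rintro ⟨p, q, r, s⟩ hx
          simp only [Finset.mem_filter, mem_rects, Prod.mk.injEq] at hx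
          obtain ⟨⟨⟨⟨hp, hq, hr, hs⟩, h⟩, hx⟩, rfl, rfl, rfl⟩ := hx
          refine Finset.mem_product.2 ⟨mem_poorPairs.2 ⟨⟨hp, hq, h.2.2.1⟩, rfl, rfl, ?_⟩,
            mem_poorPairs.2 ⟨⟨hp, hs, h.2.2.2⟩, rfl, rfl, ?_⟩⟩
          · have := (not_or.1 hx.2.1).1
            rw [← lineCount_translate (p := p)] at this
            · exact not_lt.1 this
            · simp only [dot, perp]; ring
          · have := (not_or.1 hx.2.2.2).2
            dsimp only at this
            rw [lineCount_of_dot h.ne_zero h.flip.ne_zero h.2.1,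
              ← lineCount_translate (p := p)] at this
            · exact not_lt.1 this
            · simp only [dot, perp]; ring
        · rintro ⟨p, q, r, s⟩ hx ⟨p', q', r', s'⟩ hx' h
          simp only [Prod.mk.injEq] at h
          obtain ⟨⟨rfl, rfl⟩, -, rfl⟩ := h
          have h1 := (mem_rects.1 (Finset.mem_filter.1 (Finset.mem_filter.1 hx).1).1).2.1
          have h2 := (mem_rects.1 (Finset.mem_filter.1 (Finset.mem_filter.1 hx').1).1).2.1
          have : r = r' := add_left_cancel (h1.trans h2.symm)
          rw [this]
        · intro x hx
          have h := (mem_rects.1 (Finset.mem_filter.1 (Finset.mem_filter.1 hx).1).1).2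
          rw [if_pos, mul_one]
          refine Prod.ext rfl ((direction_eq_iff h.ne_zero (perp_ne_zero h.flip.ne_zero)).2 ?_)
          rw [dot_perp_perp, h.2.1]
    _ ≤ _ := by
        refine pairing_le_sqrt.trans ?_
        rw [pairing_normalKey_eq]
        have e : (200000 : ℝ) = √200000 * √200000 := (Real.mul_self_sqrt (by norm_num)).symm
        have h1 := Real.sqrt_le_sqrt (pairing_rayKey_le hρ hρ6 hlv i hj)
        have h2 := Real.sqrt_le_sqrt (pairing_rayKey_le hρ hρ6 hlv i hk)
        rw [Real.sqrt_mul (by norm_num)] at h1 h2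
        refine (mul_le_mul h1 h2 (Real.sqrt_nonneg _) (by positivity)).trans (le_of_eq ?_)
        nth_rw 3 [e]
        ring

open Classical in
lemma sum_poorRect_top_le (hlm : ∀ p ∈ S, lv p < m)
    (hlv : ∀ j, (levelSet S lv j).card ≤ 2 ^ j) (hf : ∀ p, 0 ≤ f p)
    (hfF : ∀ p ∈ S, f p ≤ F (lv p)) (hF : Antitone F) (hF0 : ∀ j, 0 ≤ F j) :
    ∑ x ∈ ((rects S).filter (IsPoorRect S lv)).filter
        (fun x => lv x.1 ≤ lv x.2.2.1 ∧ lv x.2.1 ≤ lv x.2.2.1 ∧ lv x.2.2.2 ≤ lv x.2.2.1),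
      f x.1 * f x.2.1 * f x.2.2.1 * f x.2.2.2 ≤
      200000 * (53 * m * (∑ j ∈ Finset.range m, 2 ^ j * F j ^ 2) ^ 2) := by
  obtain ⟨ρ, hρ, hρ6⟩ : ∃ ρ : ℝ, 0 < ρ ∧ ρ ^ 6 = 2 :=
    ⟨2 ^ ((6 : ℕ) : ℝ)⁻¹, by positivity, Real.rpow_inv_natCast_pow (by norm_num) (by norm_num)⟩
  set W : ℕ × ℕ × ℕ → ℝ :=
    fun t => F t.1 * F t.2.1 * F t.2.2 * F (max t.1 (max t.2.1 t.2.2)) with hW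
  have hW0 : ∀ t, 0 ≤ W t := fun t =>
    mul_nonneg (mul_nonneg (mul_nonneg (hF0 _) (hF0 _)) (hF0 _)) (hF0 _)
  calc _ ≤ ∑ x ∈ (rects S).filter (IsPoorRect S lv), W (lv x.1, lv x.2.1, lv x.2.2.2) := by
        refine (Finset.sum_le_sum fun x hx => ?_).trans
          (Finset.sum_le_sum_of_subset_of_nonneg (Finset.filter_subset _ _) fun x _ _ => hW0 _)
        obtain ⟨hx, h1, h2, h3⟩ := Finset.mem_filter.1 hx
        obtain ⟨m1, m2, m3, m4⟩ := (mem_rects.1 (Finset.mem_filter.1 hx).1).1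
        have h4 : f x.2.2.1 ≤ F (max (lv x.1) (max (lv x.2.1) (lv x.2.2.2))) :=
          (hfF _ m3).trans (hF (max_le h1 (max_le h2 h3)))
        calc f x.1 * f x.2.1 * f x.2.2.1 * f x.2.2.2
            = f x.1 * f x.2.1 * f x.2.2.2 * f x.2.2.1 := by ring
          _ ≤ F (lv x.1) * F (lv x.2.1) * F (lv x.2.2.2) *
              F (max (lv x.1) (max (lv x.2.1) (lv x.2.2.2))) := by
            have := hf x.1
            have := hf x.2.1
            have := hf x.2.2.1
            have := hf x.2.2.2
            have := hF0 (lv x.1)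
            have := hF0 (lv x.2.1)
            have := hF0 (lv x.2.2.2)
            gcongr
            exacts [hfF _ m1, hfF _ m2, hfF _ m4]
    _ = ∑ t ∈ Finset.range m ×ˢ Finset.range m ×ˢ Finset.range m,
          ((((rects S).filter (IsPoorRect S lv)).filter
            fun x => (lv x.1, lv x.2.1, lv x.2.2.2) = t).card : ℝ) * W t := by
        rw [← Finset.sum_fiberwise_of_maps_to (g := fun x => (lv x.1, lv x.2.1, lv x.2.2.2))
          (t := Finset.range m ×ˢ Finset.range m ×ˢ Finset.range m)]
        · refine Finset.sum_congr rfl fun t _ => ?_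
          rw [← nsmul_eq_mul, ← Finset.sum_const]
          exact Finset.sum_congr rfl fun x hx => by rw [(Finset.mem_filter.1 hx).2]
        · intro x hx
          obtain ⟨m1, m2, m3, m4⟩ := (mem_rects.1 (Finset.mem_filter.1 hx).1).1
          simp only [Finset.mem_product, Finset.mem_range]
          exact ⟨hlm _ m1, hlm _ m2, hlm _ m4⟩
    _ ≤ ∑ t ∈ Finset.range m ×ˢ Finset.range m ×ˢ Finset.range m, 200000 * (W t *
          (√(2 ^ (t.1 + t.2.1) * levelBound ρ m t.1 t.2.1) *
            √(2 ^ (t.1 + t.2.2) * levelBound ρ m t.1 t.2.2))) := by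
        refine Finset.sum_le_sum fun t ht => ?_
        simp only [Finset.mem_product, Finset.mem_range] at ht
        refine (mul_le_mul_of_nonneg_right (card_poorRect_le hρ hρ6 hlv t.1 ht.2.1 ht.2.2)
          (hW0 t)).trans (le_of_eq (by ring))
    _ ≤ _ := by
        rw [← Finset.mul_sum]
        refine mul_le_mul_of_nonneg_left ?_ (by norm_num)
        refine le_trans (le_of_eq ?_) (sum_levels_le hρ hρ6 hF0)
        rw [Finset.sum_product]
        refine Finset.sum_congr rfl fun i _ => ?_
        rw [Finset.sum_product]

open Classical in
/-- The contribution of the rectangles all of whose vertices are poor. -/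
theorem sum_rects_poor_le (hlm : ∀ p ∈ S, lv p < m)
    (hlv : ∀ j, (levelSet S lv j).card ≤ 2 ^ j) (hf : ∀ p, 0 ≤ f p)
    (hfF : ∀ p ∈ S, f p ≤ F (lv p)) (hF : Antitone F) (hF0 : ∀ j, 0 ≤ F j) :
    ∑ x ∈ (rects S).filter (IsPoorRect S lv), f x.1 * f x.2.1 * f x.2.2.1 * f x.2.2.2 ≤
      4 * (200000 * (53 * m * (∑ j ∈ Finset.range m, 2 ^ j * F j ^ 2) ^ 2)) := by
  set M : (ℤ × ℤ) × (ℤ × ℤ) × (ℤ × ℤ) × (ℤ × ℤ) → ℝ := fun x =>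
    if IsPoorRect S lv x ∧ lv x.1 ≤ lv x.2.2.1 ∧ lv x.2.1 ≤ lv x.2.2.1 ∧
      lv x.2.2.2 ≤ lv x.2.2.1 then f x.1 * f x.2.1 * f x.2.2.1 * f x.2.2.2 else 0 with hM
  have hM0 : ∀ x, 0 ≤ M x := fun x => by
    simp only [hM]
    split_ifs
    · exact mul_nonneg (mul_nonneg (mul_nonneg (hf _) (hf _)) (hf _)) (hf _)
    · exact le_rfl
  have h1 := sum_rects_shift (S := S) M
  have h2 := h1.trans (sum_rects_shift _)
  have h3 := h2.trans (sum_rects_shift _)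
  have hle : ∑ x ∈ (rects S).filter (IsPoorRect S lv), f x.1 * f x.2.1 * f x.2.2.1 * f x.2.2.2 ≤
      4 * ∑ x ∈ rects S, M x := by
    have e : 4 * ∑ x ∈ rects S, M x = ∑ x ∈ rects S, M x +
        ∑ x ∈ rects S, M (x.2.1, x.2.2.1, x.2.2.2, x.1) +
        ∑ x ∈ rects S, M (x.2.2.1, x.2.2.2, x.1, x.2.1) +
        ∑ x ∈ rects S, M (x.2.2.2, x.1, x.2.1, x.2.2.1) := by
      linarith
    rw [e, ← Finset.sum_add_distrib, ← Finset.sum_add_distrib, ← Finset.sum_add_distrib,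
      Finset.sum_filter]
    refine Finset.sum_le_sum ?_
    rintro ⟨p, q, r, s⟩ hx
    have h := (mem_rects.1 hx).2
    have c1 := hM0 (p, q, r, s)
    have c2 := hM0 (q, r, s, p)
    have c3 := hM0 (r, s, p, q)
    have c4 := hM0 (s, p, q, r)
    have p2 := isPoorRect_shift (S := S) (lv := lv) h
    have p3 := isPoorRect_shift (S := S) (lv := lv) h.shift
    have p4 := isPoorRect_shift (S := S) (lv := lv) h.shift.shift
    dsimp only at *
    split_ifs with hP
    · have key : (lv p ≤ lv r ∧ lv q ≤ lv r ∧ lv s ≤ lv r) ∨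
          (lv q ≤ lv s ∧ lv r ≤ lv s ∧ lv p ≤ lv s) ∨
          (lv r ≤ lv p ∧ lv s ≤ lv p ∧ lv q ≤ lv p) ∨
          (lv s ≤ lv q ∧ lv p ≤ lv q ∧ lv r ≤ lv q) := by omega
      have q2 := p2.2 hP
      have q3 := p3.2 q2
      have q4 := p4.2 q3
      rcases key with k | k | k | k
      · have : M (p, q, r, s) = f p * f q * f r * f s := if_pos ⟨hP, k⟩
        linarith
      · have : M (q, r, s, p) = f q * f r * f s * f p := if_pos ⟨q2, k⟩
        linarith
      · have : M (r, s, p, q) = f r * f s * f p * f q := if_pos ⟨q3, k⟩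
        linarith
      · have : M (s, p, q, r) = f s * f p * f q * f r := if_pos ⟨q4, k⟩
        linarith
    · linarith
  refine hle.trans (mul_le_mul_of_nonneg_left ?_ (by norm_num))
  refine le_trans (le_of_eq ?_) (sum_poorRect_top_le hlm hlv hf hfF hF hF0)
  rw [Finset.filter_filter, Finset.sum_filter]

end PoorRectangles

section Levels

lemma sum_dyadic_le {G : ℕ → ℝ} (hG : Antitone G) (hG0 : ∀ n, 0 ≤ G n) (n : ℕ) :
    ∑ j ∈ Finset.range (n + 1), 2 ^ j * G (2 ^ j - 1) ≤ 2 * ∑ k ∈ Finset.range (2 ^ n), G k := by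
  have h := Finset.sum_condensed_le (f := fun k => G (k - 1))
    (fun _ _ _ h => hG (Nat.sub_le_sub_right h 1)) n
  simp only [nsmul_eq_mul, Nat.cast_pow, Nat.cast_ofNat, Nat.sub_self] at h
  rw [← Finset.sum_Ico_add' (fun k => G (k - 1)) 1 (2 ^ n) 1] at h
  simp only [Nat.add_sub_cancel] at h
  have h2 := Finset.sum_eq_sum_Ico_succ_bot (Nat.two_pow_pos n) G
  rw [← Finset.range_eq_Ico, zero_add] at h2
  rw [h2]
  linarith [hG0 0]

lemma exists_equiv_antitone {α : Type*} (S : Finset α) (f : α → ℝ) :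
    ∃ e : Fin S.card ≃ S, Antitone fun i => f (e i) := by
  let g : Fin S.card → ℝ := fun i => -f (S.equivFin.symm i)
  refine ⟨(Tuple.sort g).trans S.equivFin.symm, fun i j hij => ?_⟩
  exact neg_le_neg_iff.1 (Tuple.monotone_sort g hij)

lemma exists_levels {S : Finset (ℤ × ℤ)} (hS : S.Nonempty) {f : ℤ × ℤ → ℝ} (hf : ∀ p, 0 ≤ f p) :
    ∃ (lv : ℤ × ℤ → ℕ) (F : ℕ → ℝ), (∀ p ∈ S, lv p < Nat.log 2 S.card + 1) ∧
      (∀ j, (levelSet S lv j).card ≤ 2 ^ j) ∧ (∀ p ∈ S, f p ≤ F (lv p)) ∧ Antitone F ∧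
      (∀ j, 0 ≤ F j) ∧
      ∑ j ∈ Finset.range (Nat.log 2 S.card + 1), 2 ^ j * F j ^ 2 ≤ 2 * ∑ p ∈ S, f p ^ 2 := by
  classical
  obtain ⟨e, he⟩ := exists_equiv_antitone S f
  set rank : ℤ × ℤ → ℕ := fun p => if h : p ∈ S then (e.symm ⟨p, h⟩ : ℕ) else 0 with hrank
  set g : ℕ → ℝ := fun n => if h : n < S.card then f (e ⟨n, h⟩) else 0 with hg
  have hrank' : ∀ p (h : p ∈ S), rank p = e.symm ⟨p, h⟩ := fun p h => dif_pos h
  have hlt : ∀ p ∈ S, rank p < S.card := fun p h => by rw [hrank' p h]; exact Fin.is_lt _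
  have hgr : ∀ p ∈ S, g (rank p) = f p := fun p h => by
    simp only [hg, dif_pos (hlt p h)]
    simp only [hrank' p h, Fin.eta, Equiv.apply_symm_apply]
  have hg0 : ∀ n, 0 ≤ g n := fun n => by
    simp only [hg]
    split_ifs
    exacts [hf _, le_rfl]
  have hganti : Antitone g := fun a b hab => by
    by_cases hb : b < S.card
    · simp only [hg, dif_pos hb, dif_pos (hab.trans_lt hb)]
      exact he (Fin.mk_le_mk.2 hab)
    · have : g b = 0 := dif_neg hb
      rw [this]
      exact hg0 a
  have hinj : Set.InjOn rank S := fun p hp q hq h => by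
    rw [hrank' p hp, hrank' q hq] at h
    simpa using e.symm.injective (Fin.ext h)
  refine ⟨fun p => Nat.log 2 (rank p + 1), fun j => g (2 ^ j - 1), fun p hp => ?_, fun j => ?_,
    fun p hp => ?_, fun i j hij => ?_, fun j => hg0 _, ?_⟩
  · exact Nat.lt_succ_of_le (Nat.log_mono_right (hlt p hp))
  · refine (Finset.card_le_card_of_injOn (t := Finset.Ico (2 ^ j - 1) (2 ^ (j + 1) - 1)) rank
      (fun p hp => ?_) (hinj.mono (Finset.coe_subset.2 (Finset.filter_subset _ _)))).trans
      (le_of_eq ?_)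
    · have h := (mem_levelSet.1 hp).2
      have h1 := Nat.pow_log_le_self 2 (Nat.succ_ne_zero (rank p))
      have h2 := Nat.lt_pow_succ_log_self one_lt_two (rank p + 1)
      rw [Nat.succ_eq_add_one, h] at h1
      rw [Nat.succ_eq_add_one, h] at h2
      simp only [Finset.coe_Ico, Set.mem_Ico]
      omega
    · rw [Nat.card_Ico, pow_succ]
      have := Nat.two_pow_pos j
      omega
  · rw [← hgr p hp]
    refine hganti ?_
    have h1 := Nat.pow_log_le_self 2 (Nat.succ_ne_zero (rank p))
    rw [Nat.succ_eq_add_one] at h1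
    dsimp only
    omega
  · exact hganti (Nat.sub_le_sub_right (Nat.pow_le_pow_right two_pos hij) 1)
  · refine (sum_dyadic_le (G := fun n => g n ^ 2) (fun a b hab => ?_) (fun n => sq_nonneg _)
      _).trans ?_
    · exact pow_le_pow_left₀ (hg0 _) (hganti hab) 2
    · refine mul_le_mul_of_nonneg_left ?_ two_pos.le
      refine (Finset.sum_le_sum_of_subset_of_nonneg (Finset.range_mono
        (Nat.pow_log_le_self 2 hS.card_pos.ne')) fun _ _ _ => sq_nonneg _).trans (le_of_eq ?_)
      rw [Finset.sum_range, ← Finset.sum_coe_sort S, ← Equiv.sum_comp e]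
      refine Finset.sum_congr rfl fun i _ => ?_
      simp only [hg, dif_pos i.is_lt, Fin.eta]

end Levels

section Energy

lemma log_two_succ_le {n : ℕ} (hn : n ≠ 0) :
    ((Nat.log 2 n + 1 : ℕ) : ℝ) ≤ 3 * max 1 (Real.log n) := by
  have h1 : ((2 : ℝ) ^ Nat.log 2 n) ≤ n := by exact_mod_cast Nat.pow_log_le_self 2 hn
  have h2 := Real.log_le_log (by positivity) h1
  rw [Real.log_pow] at h2
  have h3 : (1 / 2 : ℝ) ≤ Real.log 2 := by linarith [Real.log_two_gt_d9]
  have h4 : (Nat.log 2 n : ℝ) * (1 / 2) ≤ Nat.log 2 n * Real.log 2 :=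
    mul_le_mul_of_nonneg_left h3 (Nat.cast_nonneg _)
  push_cast
  linarith [le_max_left 1 (Real.log n), le_max_right 1 (Real.log n)]

/-- The weighted number of rectangles, including degenerate ones. -/
theorem pairing_sideKey_le_log {S : Finset (ℤ × ℤ)} (hS : S.Nonempty) {f : ℤ × ℤ → ℝ}
    (hf : ∀ p, 0 ≤ f p) :
    pairing S.offDiag sideKey (fun a => f a.1 * f a.2) S.offDiag sideKey
        (fun a => f a.1 * f a.2) ≤
      4200000000 * max 1 (Real.log S.card) * (∑ p ∈ S, f p ^ 2) ^ 2 := by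
  classical
  obtain ⟨lv, F, hlm, hlv, hfF, hF, hF0, hΛ⟩ := exists_levels hS hf
  have h1 := sum_rects_rich_le hlm hlv hf hfF
  have h2 := sum_rects_poor_le hlm hlv hf hfF hF hF0
  refine (pairing_sideKey_le (S := S) hf (isRich_congr (S := S) (lv := lv))).trans ?_
  have h4 := add_le_add_left (add_le_add (mul_le_mul_of_nonneg_left h1 (by norm_num : (0 : ℝ) ≤ 8))
    (mul_le_mul_of_nonneg_left h2 (by norm_num : (0 : ℝ) ≤ 8))) (24 * (∑ p ∈ S, f p ^ 2) ^ 2)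
  refine le_trans (le_of_eq ?_) (h4.trans ?_)
  · congr! 4
    ext x
    simp only [Finset.mem_filter, IsPoorRect]
  have h3 := log_two_succ_le hS.card_pos.ne'
  set A := ∑ p ∈ S, f p ^ 2
  set Λ := ∑ j ∈ Finset.range (Nat.log 2 S.card + 1), 2 ^ j * F j ^ 2
  set L := max 1 (Real.log S.card)
  set m : ℝ := ((Nat.log 2 S.card + 1 : ℕ) : ℝ)
  have hm : (1 : ℝ) ≤ m := by simp [m]
  have hA : 0 ≤ A := Finset.sum_nonneg fun _ _ => sq_nonneg _
  have hΛ0 : 0 ≤ Λ := Finset.sum_nonneg fun _ _ => by positivity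
  have e1 : Λ * A ≤ 2 * A ^ 2 := by nlinarith
  have e2 : m * Λ ^ 2 ≤ m * (4 * A ^ 2) := by
    refine mul_le_mul_of_nonneg_left ?_ (by linarith)
    nlinarith
  have e3 : A ^ 2 ≤ m * A ^ 2 := le_mul_of_one_le_left (sq_nonneg _) hm
  have e4 : m * A ^ 2 ≤ 3 * L * A ^ 2 := mul_le_mul_of_nonneg_right h3 (sq_nonneg _)
  have e5 : 0 ≤ L * A ^ 2 := mul_nonneg (zero_le_one.trans (le_max_left _ _)) (sq_nonneg _)
  linarith

end Energy

section Fourier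

open Complex ComplexConjugate

/-- The plane wave with spatial frequency `n.1` and temporal frequency `n.2`. -/
noncomputable def wave (n : (ℤ × ℤ) × ℤ) (t : ℝ) (x : ℝ × ℝ) : ℂ :=
  exp (I * ((n.1.1 : ℂ) * (x.1 : ℂ) + (n.1.2 : ℂ) * (x.2 : ℂ) - (t : ℂ) * (n.2 : ℂ)))

lemma wave_mul_conj (m n : (ℤ × ℤ) × ℤ) (t : ℝ) (x : ℝ × ℝ) :
    wave m t x * conj (wave n t x) = wave (m - n) t x := by
  simp only [wave, ← exp_conj, ← exp_add, map_mul, map_sub, map_add, conj_I, conj_ofReal,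
    map_intCast, Prod.fst_sub, Prod.snd_sub]
  congr 1
  push_cast
  ring

lemma continuous_wave (n : (ℤ × ℤ) × ℤ) : Continuous fun y : ℝ × (ℝ × ℝ) => wave n y.1 y.2 := by
  unfold wave
  fun_prop

lemma integral_exp_int_mul (n : ℤ) :
    ∫ x in (0 : ℝ)..(2 * π), exp (n * I * x) = if n = 0 then (2 * π : ℂ) else 0 := by
  split_ifs with h
  · simp [h]
  · have h0 : (n : ℂ) * I ≠ 0 := mul_ne_zero (by exact_mod_cast h) I_ne_zero
    rw [integral_exp_mul_complex h0]
    have : (n : ℂ) * I * ((2 * π : ℝ) : ℂ) = n * (2 * π * I) := by push_cast; ring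
    rw [this, exp_int_mul_two_pi_mul_I]
    simp

lemma integral_wave_space (n : (ℤ × ℤ) × ℤ) (t : ℝ) :
    ∫ x in Set.Icc ((0 : ℝ), (0 : ℝ)) ((2 * π), (2 * π)), wave n t x =
      exp ((-n.2 : ℤ) * I * t) *
        ((if n.1.1 = 0 then (2 * π : ℂ) else 0) * if n.1.2 = 0 then (2 * π : ℂ) else 0) := by
  have h : ∀ k : ℤ, ∫ x in Set.Icc (0 : ℝ) (2 * π), exp (k * I * x) =
      if k = 0 then (2 * π : ℂ) else 0 := fun k => by
    rw [integral_Icc_eq_integral_Ioc, ← intervalIntegral.integral_of_le Real.two_pi_pos.le,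
      integral_exp_int_mul]
  rw [← h, ← h, ← Set.Icc_prod_Icc, Measure.volume_eq_prod, ← setIntegral_prod_mul,
    ← integral_const_mul]
  congr 1
  funext x
  simp only [wave, ← exp_add]
  congr 1
  push_cast
  ring

lemma integral_wave (n : (ℤ × ℤ) × ℤ) :
    ∫ t in (0 : ℝ)..(2 * π), ∫ x in Set.Icc ((0 : ℝ), (0 : ℝ)) ((2 * π), (2 * π)), wave n t x =
      if n = 0 then ((2 * π) ^ 3 : ℂ) else 0 := by
  simp only [integral_wave_space]
  rw [intervalIntegral.integral_mul_const, integral_exp_int_mul]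
  obtain ⟨⟨a, b⟩, c⟩ := n
  simp only [neg_eq_zero, Prod.mk_eq_zero]
  by_cases ha : a = 0 <;> by_cases hb : b = 0 <;> by_cases hc : c = 0 <;>
    simp [ha, hb, hc]
  ring

lemma integral_norm_sq_le {ι : Type*} (T : Finset ι) (k : ι → (ℤ × ℤ) × ℤ) (c : ι → ℂ) :
    ∫ t in (0 : ℝ)..(2 * π), ∫ x in Set.Icc ((0 : ℝ), (0 : ℝ)) ((2 * π), (2 * π)),
      ‖∑ i ∈ T, c i * wave (k i) t x‖ ^ 2 ≤
      (2 * π) ^ 3 * pairing T k (fun i => ‖c i‖) T k (fun i => ‖c i‖) := by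
  have hpt : ∀ (t : ℝ) (x : ℝ × ℝ), ((‖∑ i ∈ T, c i * wave (k i) t x‖ ^ 2 : ℝ) : ℂ) =
      ∑ i ∈ T, ∑ j ∈ T, c i * conj (c j) * wave (k i - k j) t x := by
    intro t x
    push_cast
    rw [← mul_conj', map_sum, Finset.sum_mul_sum]
    refine Finset.sum_congr rfl fun i _ => Finset.sum_congr rfl fun j _ => ?_
    rw [map_mul, ← wave_mul_conj]
    ring
  have hx : ∀ t : ℝ, ((∫ x in Set.Icc ((0 : ℝ), (0 : ℝ)) ((2 * π), (2 * π)),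
      ‖∑ i ∈ T, c i * wave (k i) t x‖ ^ 2 : ℝ) : ℂ) = ∑ i ∈ T, ∑ j ∈ T, c i * conj (c j) *
        ∫ x in Set.Icc ((0 : ℝ), (0 : ℝ)) ((2 * π), (2 * π)), wave (k i - k j) t x := by
    intro t
    have hint : ∀ n, IntegrableOn (fun x => wave n t x)
        (Set.Icc ((0 : ℝ), (0 : ℝ)) ((2 * π), (2 * π))) := fun n =>
      ((continuous_wave n).comp (Continuous.prodMk_right t)).continuousOn.integrableOn_compact
        isCompact_Icc
    rw [← integral_complex_ofReal]
    simp only [hpt]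
    rw [integral_finsetSum _ fun i _ => integrable_finsetSum _ fun j _ =>
      (hint _).const_mul _]
    refine Finset.sum_congr rfl fun i _ => ?_
    rw [integral_finsetSum _ fun j _ => (hint _).const_mul _]
    exact Finset.sum_congr rfl fun j _ => integral_const_mul _ _
  have ht : ((∫ t in (0 : ℝ)..(2 * π), ∫ x in Set.Icc ((0 : ℝ), (0 : ℝ)) ((2 * π), (2 * π)),
      ‖∑ i ∈ T, c i * wave (k i) t x‖ ^ 2 : ℝ) : ℂ) =
      ∑ i ∈ T, ∑ j ∈ T, c i * conj (c j) * if k i = k j then ((2 * π) ^ 3 : ℂ) else 0 := by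
    have hint : ∀ n, IntervalIntegrable (fun t => ∫ x in
        Set.Icc ((0 : ℝ), (0 : ℝ)) ((2 * π), (2 * π)), wave n t x) volume 0 (2 * π) := fun n => by
      simp only [integral_wave_space]
      exact Continuous.intervalIntegrable (by fun_prop) _ _
    rw [← intervalIntegral.integral_ofReal]
    simp only [hx]
    have hs : ∀ i ∈ T, IntervalIntegrable (fun t => ∑ j ∈ T, c i * conj (c j) * ∫ x in
        Set.Icc ((0 : ℝ), (0 : ℝ)) ((2 * π), (2 * π)), wave (k i - k j) t x)
        volume 0 (2 * π) := fun i _ => by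
      simp only [integral_wave_space]
      exact Continuous.intervalIntegrable (by fun_prop) _ _
    rw [intervalIntegral.integral_finsetSum hs]
    refine Finset.sum_congr rfl fun i _ => ?_
    rw [intervalIntegral.integral_finsetSum fun j _ => (hint _).const_mul _]
    refine Finset.sum_congr rfl fun j _ => ?_
    rw [intervalIntegral.integral_const_mul, integral_wave]
    simp only [sub_eq_zero]
  refine (le_abs_self _).trans ?_
  rw [← Real.norm_eq_abs, ← norm_real, ht, pairing, Finset.mul_sum]
  refine norm_sum_le_of_le _ fun i _ => ?_
  rw [Finset.mul_sum]
  refine norm_sum_le_of_le _ fun j _ => ?_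
  split_ifs
  · simp only [norm_mul, norm_pow, norm_conj, norm_real, norm_ofNat, Real.norm_eq_abs,
      abs_of_pos Real.pi_pos]
    exact le_of_eq (by ring)
  · simp

/-- The space-time frequency of the product of the waves with spatial frequencies `a.1` and
`-a.2`. -/
def freqKey (a : (ℤ × ℤ) × (ℤ × ℤ)) : (ℤ × ℤ) × ℤ :=
  (a.1, dot a.1 a.1) - (a.2, dot a.2 a.2)

lemma freqKey_eq_iff {a b : (ℤ × ℤ) × (ℤ × ℤ)} :
    freqKey a = freqKey b ↔ sideKey a = sideKey b := by
  obtain ⟨⟨a1, a2⟩, ⟨a3, a4⟩⟩ := a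
  obtain ⟨⟨b1, b2⟩, ⟨b3, b4⟩⟩ := b
  simp only [freqKey, sideKey, dot, Prod.mk_sub_mk, Prod.mk.injEq]
  constructor
  · rintro ⟨⟨h1, h2⟩, h3⟩
    obtain rfl : a3 = a1 - b1 + b3 := by linarith
    obtain rfl : a4 = a2 - b2 + b4 := by linarith
    refine ⟨⟨by ring, by ring⟩, ?_⟩
    nlinarith
  · rintro ⟨⟨h1, h2⟩, h3⟩
    obtain rfl : a3 = a1 - b1 + b3 := by linarith
    obtain rfl : a4 = a2 - b2 + b4 := by linarith
    refine ⟨⟨by ring, by ring⟩, ?_⟩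
    nlinarith

lemma pairing_freqKey (S : Finset (ℤ × ℤ)) (f : ℤ × ℤ → ℝ) :
    pairing (S ×ˢ S) freqKey (fun a => f a.1 * f a.2) (S ×ˢ S) freqKey (fun a => f a.1 * f a.2) =
      (∑ p ∈ S, f p ^ 2) ^ 2 + pairing S.offDiag sideKey (fun a => f a.1 * f a.2) S.offDiag sideKey
        (fun a => f a.1 * f a.2) := by
  have h0 : ∀ {a b}, a ∈ S.diag → b ∈ S.offDiag → sideKey a ≠ sideKey b := by
    intro a b ha hb h
    have h1 : a.2 - a.1 = b.2 - b.1 := (Prod.ext_iff.1 h).1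
    rw [← (Finset.mem_diag.1 ha).2, sub_self] at h1
    exact (Finset.mem_offDiag.1 hb).2.2 (sub_eq_zero.1 h1.symm).symm
  have hd : ∀ {a b}, a ∈ S.diag → b ∈ S.diag → sideKey a = sideKey b := by
    intro a b ha hb
    simp [sideKey, ← (Finset.mem_diag.1 ha).2, ← (Finset.mem_diag.1 hb).2, dot]
  simp only [pairing, freqKey_eq_iff]
  rw [← Finset.diag_union_offDiag, Finset.sum_union (Finset.disjoint_diag_offDiag S)]
  congr 1
  · have : ∑ p ∈ S, f p ^ 2 = ∑ a ∈ S.diag, f a.1 * f a.2 := by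
      rw [Finset.sum_diag]
      simp only [pow_two]
    rw [pow_two, this, Finset.sum_mul_sum]
    refine Finset.sum_congr rfl fun a ha => ?_
    rw [Finset.sum_union (Finset.disjoint_diag_offDiag S),
      Finset.sum_congr rfl fun b hb => if_pos (hd ha hb),
      Finset.sum_congr rfl fun b hb => if_neg (h0 ha hb)]
    simp
  · refine Finset.sum_congr rfl fun a ha => ?_
    rw [Finset.sum_union (Finset.disjoint_diag_offDiag S),
      Finset.sum_congr rfl fun b hb => if_neg (h0 hb ha).symm]
    simp

/-- The fourth power of the Strichartz norm is controlled by the weighted number of rectangles. -/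
theorem integral_norm_pow_four_le (S : Finset (ℤ × ℤ)) (a : ℤ × ℤ → ℂ) :
    ∫ t in (0 : ℝ)..(2 * π), ∫ x in Set.Icc ((0 : ℝ), (0 : ℝ)) ((2 * π), (2 * π)),
      ‖∑ ξ ∈ S, a ξ * wave (ξ, dot ξ ξ) t x‖ ^ 4 ≤
      (2 * π) ^ 3 * ((∑ p ∈ S, ‖a p‖ ^ 2) ^ 2 + pairing S.offDiag sideKey
        (fun e => ‖a e.1‖ * ‖a e.2‖) S.offDiag sideKey (fun e => ‖a e.1‖ * ‖a e.2‖)) := by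
  rw [← pairing_freqKey S fun p => ‖a p‖]
  refine le_trans (le_of_eq ?_) ((integral_norm_sq_le (S ×ˢ S) freqKey
    fun e => a e.1 * conj (a e.2)).trans (le_of_eq ?_))
  · refine intervalIntegral.integral_congr fun t _ => integral_congr_ae (.of_forall fun x => ?_)
    beta_reduce
    have : ∑ e ∈ S ×ˢ S, a e.1 * conj (a e.2) * wave (freqKey e) t x =
        (∑ ξ ∈ S, a ξ * wave (ξ, dot ξ ξ) t x) *
          conj (∑ ξ ∈ S, a ξ * wave (ξ, dot ξ ξ) t x) := by
      rw [map_sum, Finset.sum_mul_sum, Finset.sum_product]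
      refine Finset.sum_congr rfl fun p _ => Finset.sum_congr rfl fun q _ => ?_
      rw [freqKey, ← wave_mul_conj, map_mul]
      ring
    rw [this, norm_mul, norm_conj]
    ring
  · simp only [norm_mul, norm_conj]

end Fourier
end Strichartz

/-- **Sharp L⁴ Strichartz estimate on 𝕋² (Theorem 1.1).**
There exists `c > 0` such that for every finite nonempty set `S ⊂ ℤ²` and every
`a : ℤ² → ℂ` supported on `S`, the free Schrödinger evolution
`u(t,x) = ∑_{ξ ∈ S} a ξ · exp(i(ξ·x − t|ξ|²))` satisfies
`‖u‖_{L⁴([0,2π]×𝕋²)} ≤ c (Log #S)^{1/4} ‖a‖_{ℓ²}`, where `Log x = max 1 (ln x)`.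
The integral over the torus `𝕋² = (ℝ/2πℤ)²` is written as an integral over the
fundamental domain `[0,2π]²`. -/
theorem sharp_L4_strichartz_T2 :
    ∃ c : ℝ, 0 < c ∧
      ∀ (S : Finset (ℤ × ℤ)) (a : ℤ × ℤ → ℂ), S.Nonempty → (∀ ξ ∉ S, a ξ = 0) →
        (∫ t in (0:ℝ)..(2 * π),
            ∫ x in Set.Icc ((0:ℝ), (0:ℝ)) ((2 * π), (2 * π)),
              ‖∑ ξ ∈ S, a ξ * Complex.exp (Complex.I *
                  ((ξ.1 : ℂ) * (x.1 : ℂ) + (ξ.2 : ℂ) * (x.2 : ℂ)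
                    - (t : ℂ) * ((ξ.1 : ℂ) ^ 2 + (ξ.2 : ℂ) ^ 2)))‖ ^ 4) ^ ((1:ℝ)/4)
          ≤ c * (max 1 (Real.log (S.card : ℝ))) ^ ((1:ℝ)/4) *
              (∑ ξ ∈ S, ‖a ξ‖ ^ 2) ^ ((1:ℝ)/2) := by
  refine ⟨((2 * π) ^ 3 * 4200000001) ^ ((1 : ℝ) / 4), by positivity, fun S a hS _ => ?_⟩
  have hw : ∀ (ξ : ℤ × ℤ) (t : ℝ) (x : ℝ × ℝ), Complex.exp (Complex.I *
      ((ξ.1 : ℂ) * (x.1 : ℂ) + (ξ.2 : ℂ) * (x.2 : ℂ)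
        - (t : ℂ) * ((ξ.1 : ℂ) ^ 2 + (ξ.2 : ℂ) ^ 2))) =
      Strichartz.wave (ξ, Strichartz.dot ξ ξ) t x := by
    intro ξ t x
    simp only [Strichartz.wave, Strichartz.dot]
    push_cast
    simp only [pow_two]
  simp only [hw]
  have h := Strichartz.integral_norm_pow_four_le S a
  have h1 := Strichartz.pairing_sideKey_le_log hS fun p => norm_nonneg (a p)
  set A := ∑ ξ ∈ S, ‖a ξ‖ ^ 2
  set L := max 1 (Real.log S.card)
  have hA : 0 ≤ A := Finset.sum_nonneg fun _ _ => sq_nonneg _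
  have hL : 1 ≤ L := le_max_left _ _
  have hA2 : A ^ 2 ≤ L * A ^ 2 := le_mul_of_one_le_left (sq_nonneg _) hL
  have hsq : A ^ ((1 : ℝ) / 2) = (A ^ 2) ^ ((1 : ℝ) / 4) := by
    rw [← Real.rpow_natCast_mul hA]
    norm_num
  rw [hsq, ← Real.mul_rpow (by positivity) (by positivity),
    ← Real.mul_rpow (by positivity) (by positivity)]
  refine Real.rpow_le_rpow ?_ (h.trans ?_) (by norm_num)
  · exact intervalIntegral.integral_nonneg Real.two_pi_pos.le fun t _ =>
      integral_nonneg fun x => by positivity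
  · rw [mul_assoc, mul_assoc]
    refine mul_le_mul_of_nonneg_left ?_ (by positivity)
    linarith
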